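/- Let δ ∈ (0, 1/2] and ε ∈ (0, 1) with 1/ε ∈ ℤ. For every finite set I of δ-skewed items there exists a guillotinable packing of I into unit square bins using at most (4/3)·(1+8δ)·(1+7ε)·opt(I) + 8/ε² + 30 bins; equivalently, opt_g(I) ≤ (4/3)(1+8δ)(1+7ε)·opt(I) + 8/ε² + 30. -/

import Mathlib

/-- An axis-aligned, non-rotated packing of items (item `i` has width `w i`
and height `h i`) into `N` unit square bins: each item gets a bin index and
coordinates for its bottom-left corner, each item lies inside its bin, and
the interiors of any two items placed in the same bin are disjoint. -/
structure BinPacking {ι : Type} [Fintype ι] (w h : ι → ℝ) (N : ℕ) where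
  bin : ι → Fin N
  x : ι → ℝ
  y : ι → ℝ
  x_nonneg : ∀ i, 0 ≤ x i
  y_nonneg : ∀ i, 0 ≤ y i
  x_add_le : ∀ i, x i + w i ≤ 1
  y_add_le : ∀ i, y i + h i ≤ 1
  disj : ∀ i j, i ≠ j → bin i = bin j →
    (Set.Ioo (x i) (x i + w i) ×ˢ Set.Ioo (y i) (y i + h i)) ∩
      (Set.Ioo (x j) (x j + w j) ×ˢ Set.Ioo (y j) (y j + h j)) = ∅

/-- The minimum number of unit square bins needed to pack the items. -/
noncomputable def opt {ι : Type} [Fintype ι] (w h : ι → ℝ) : ℕ :=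
  sInf {N | Nonempty (BinPacking w h N)}

/-- An axis-aligned rectangle given by the coordinates of its left, bottom,
right and top edges. -/
structure Rect where
  x1 : ℝ
  y1 : ℝ
  x2 : ℝ
  y2 : ℝ

/-- The open interior of a rectangle. -/
def Rect.interior (r : Rect) : Set (ℝ × ℝ) := Set.Ioo r.x1 r.x2 ×ˢ Set.Ioo r.y1 r.y2

/-- `Guillotine p S R` : the rectangles `p i` for `i ∈ S`, packed inside the
region `R`, are guillotine-separable: either `S` has at most one element, or
there is a vertical or horizontal end-to-end cut of `R` meeting the interior
of no rectangle of `S` such that the induced packings in the two resulting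
subregions are recursively guillotine-separable. -/
inductive Guillotine {ι : Type} (p : ι → Rect) : Finset ι → Rect → Prop
  | leaf (S : Finset ι) (R : Rect) (hcard : S.card ≤ 1) : Guillotine p S R
  | vert (S : Finset ι) (R : Rect) (c : ℝ) (h1 : R.x1 ≤ c) (h2 : c ≤ R.x2)
      (hsep : ∀ i ∈ S, (p i).x2 ≤ c ∨ c ≤ (p i).x1)
      (hleft : Guillotine p (S.filter fun i => (p i).x2 ≤ c) ⟨R.x1, R.y1, c, R.y2⟩)
      (hright : Guillotine p (S.filter fun i => ¬ (p i).x2 ≤ c) ⟨c, R.y1, R.x2, R.y2⟩) :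
      Guillotine p S R
  | horiz (S : Finset ι) (R : Rect) (c : ℝ) (h1 : R.y1 ≤ c) (h2 : c ≤ R.y2)
      (hsep : ∀ i ∈ S, (p i).y2 ≤ c ∨ c ≤ (p i).y1)
      (hbot : Guillotine p (S.filter fun i => (p i).y2 ≤ c) ⟨R.x1, R.y1, R.x2, c⟩)
      (htop : Guillotine p (S.filter fun i => ¬ (p i).y2 ≤ c) ⟨R.x1, c, R.x2, R.y2⟩) :
      Guillotine p S R

/-- The placed rectangle of item `i` in the packing `P`. -/
noncomputable def BinPacking.rect {ι : Type} [Fintype ι] {w h : ι → ℝ} {N : ℕ}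
    (P : BinPacking w h N) (i : ι) : Rect :=
  ⟨P.x i, P.y i, P.x i + w i, P.y i + h i⟩

/-- A bin packing is guillotinable if the packing inside every bin is
guillotine-separable. -/
def BinPacking.Guillotinable {ι : Type} [Fintype ι] {w h : ι → ℝ} {N : ℕ}
    (P : BinPacking w h N) : Prop :=
  ∀ b : Fin N, Guillotine P.rect (Finset.univ.filter fun i => P.bin i = b) ⟨0, 0, 1, 1⟩

/-- The minimum number of unit square bins in a guillotinable packing. -/
noncomputable def optg {ι : Type} [Fintype ι] (w h : ι → ℝ) : ℕ :=
  sInf {N | ∃ P : BinPacking w h N, P.Guillotinable}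

/-- `GPack w h S a b`: the items of `S` have a guillotine packing into a rectangle of width `a`
and height `b`, described by its tree of cuts. -/
inductive GPack {ι : Type} [DecidableEq ι] (w h : ι → ℝ) : Finset ι → ℝ → ℝ → Prop
  | empty (a b : ℝ) (ha : 0 ≤ a) (hb : 0 ≤ b) : GPack w h ∅ a b
  | single (i : ι) (a b : ℝ) (ha : w i ≤ a) (hb : h i ≤ b) : GPack w h {i} a b
  | side (S T : Finset ι) (a₁ a₂ b : ℝ) (hST : Disjoint S T) (hS : GPack w h S a₁ b)
      (hT : GPack w h T a₂ b) : GPack w h (S ∪ T) (a₁ + a₂) b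
  | stack (S T : Finset ι) (a b₁ b₂ : ℝ) (hST : Disjoint S T) (hS : GPack w h S a b₁)
      (hT : GPack w h T a b₂) : GPack w h (S ∪ T) a (b₁ + b₂)

theorem GPack.transpose {ι : Type} [DecidableEq ι] {w h : ι → ℝ} {S : Finset ι} {a b : ℝ}
    (H : GPack w h S a b) : GPack h w S b a := by
  induction H with
  | empty a b ha hb => exact .empty _ _ hb ha
  | single i a b ha hb => exact .single _ _ _ hb ha
  | side S T a₁ a₂ b hST _ _ ihS ihT => exact .stack _ _ _ _ _ hST ihS ihT
  | stack S T a b₁ b₂ hST _ _ ihS ihT => exact .side _ _ _ _ _ hST ihS ihT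

theorem GPack.nonneg {ι : Type} [DecidableEq ι] {w h : ι → ℝ} (hw : ∀ i, 0 < w i)
    (hh : ∀ i, 0 < h i) {S : Finset ι} {a b : ℝ} (H : GPack w h S a b) : 0 ≤ a ∧ 0 ≤ b := by
  induction H with
  | empty a b ha hb => exact ⟨ha, hb⟩
  | single i a b ha hb => exact ⟨(hw i).le.trans ha, (hh i).le.trans hb⟩
  | side S T a₁ a₂ b hST _ _ ihS ihT => exact ⟨add_nonneg ihS.1 ihT.1, ihS.2⟩
  | stack S T a b₁ b₂ hST _ _ ihS ihT => exact ⟨ihS.1, add_nonneg ihS.2 ihT.2⟩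

theorem GPack.mono_width {ι : Type} [DecidableEq ι] {w h : ι → ℝ} {S : Finset ι} {a a' b : ℝ}
    (H : GPack w h S a b) (hb : 0 ≤ b) (haa : a ≤ a') : GPack w h S a' b := by
  have := GPack.side S ∅ a (a' - a) b (by simp) H (.empty _ _ (by linarith) hb)
  simpa using this

theorem GPack.mono_height {ι : Type} [DecidableEq ι] {w h : ι → ℝ} {S : Finset ι} {a b b' : ℝ}
    (H : GPack w h S a b) (ha : 0 ≤ a) (hbb : b ≤ b') : GPack w h S a b' :=
  (H.transpose.mono_width ha hbb).transpose

/-- Coordinates realizing a guillotine packing of `S` in the rectangle `[x₀, x₁] × [y₀, y₁]`. -/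
def Realizes {ι : Type} (w h : ι → ℝ) (S : Finset ι) (x₀ y₀ x₁ y₁ : ℝ) (x y : ι → ℝ) : Prop :=
  (∀ i ∈ S, x₀ ≤ x i ∧ x i + w i ≤ x₁ ∧ y₀ ≤ y i ∧ y i + h i ≤ y₁) ∧
  (∀ i ∈ S, ∀ j ∈ S, i ≠ j →
    x i + w i ≤ x j ∨ x j + w j ≤ x i ∨ y i + h i ≤ y j ∨ y j + h j ≤ y i) ∧
  Guillotine (fun i => ⟨x i, y i, x i + w i, y i + h i⟩) S ⟨x₀, y₀, x₁, y₁⟩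

theorem Guillotine.congr {ι : Type} {p q : ι → Rect} {S : Finset ι} {R : Rect}
    (H : Guillotine p S R) (hpq : ∀ i ∈ S, p i = q i) : Guillotine q S R := by
  induction H with
  | leaf S R hcard => exact .leaf S R hcard
  | vert S R c h1 h2 hsep _ _ ihl ihr =>
    refine .vert S R c h1 h2 (fun i hi => by rw [← hpq i hi]; exact hsep i hi) ?_ ?_
    · rw [Finset.filter_congr (q := fun i => (p i).x2 ≤ c) (fun i hi => by rw [hpq i hi])]
      exact ihl fun i hi => hpq i (Finset.mem_of_mem_filter i hi)
    · rw [Finset.filter_congr (q := fun i => ¬ (p i).x2 ≤ c) (fun i hi => by rw [hpq i hi])]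
      exact ihr fun i hi => hpq i (Finset.mem_of_mem_filter i hi)
  | horiz S R c h1 h2 hsep _ _ ihl ihr =>
    refine .horiz S R c h1 h2 (fun i hi => by rw [← hpq i hi]; exact hsep i hi) ?_ ?_
    · rw [Finset.filter_congr (q := fun i => (p i).y2 ≤ c) (fun i hi => by rw [hpq i hi])]
      exact ihl fun i hi => hpq i (Finset.mem_of_mem_filter i hi)
    · rw [Finset.filter_congr (q := fun i => ¬ (p i).y2 ≤ c) (fun i hi => by rw [hpq i hi])]
      exact ihr fun i hi => hpq i (Finset.mem_of_mem_filter i hi)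

theorem Realizes.congr {ι : Type} {w h : ι → ℝ} {S : Finset ι} {x₀ y₀ x₁ y₁ : ℝ}
    {x y x' y' : ι → ℝ} (H : Realizes w h S x₀ y₀ x₁ y₁ x y) (hx : ∀ i ∈ S, x i = x' i)
    (hy : ∀ i ∈ S, y i = y' i) : Realizes w h S x₀ y₀ x₁ y₁ x' y' := by
  obtain ⟨h1, h2, h3⟩ := H
  refine ⟨fun i hi => ?_, fun i hi j hj hij => ?_, h3.congr fun i hi => ?_⟩
  · rw [← hx i hi, ← hy i hi]; exact h1 i hi
  · rw [← hx i hi, ← hy i hi, ← hx j hj, ← hy j hj]; exact h2 i hi j hj hij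
  · simp only [hx i hi, hy i hi]

theorem Realizes.side {ι : Type} [DecidableEq ι] {w h : ι → ℝ} (hw : ∀ i, 0 < w i)
    {S T : Finset ι} {x₀ y₀ x₁ y₁ c : ℝ} {x y : ι → ℝ} (h0 : x₀ ≤ c) (h1 : c ≤ x₁)
    (HS : Realizes w h S x₀ y₀ c y₁ x y) (HT : Realizes w h T c y₀ x₁ y₁ x y) :
    Realizes w h (S ∪ T) x₀ y₀ x₁ y₁ x y := by
  obtain ⟨s1, s2, s3⟩ := HS
  obtain ⟨t1, t2, t3⟩ := HT
  refine ⟨fun i hi => ?_, fun i hi j hj hij => ?_, ?_⟩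
  · rcases Finset.mem_union.1 hi with hi | hi
    · have := s1 i hi; exact ⟨this.1, by linarith, this.2.2⟩
    · have := t1 i hi; exact ⟨by linarith, this.2⟩
  · rcases Finset.mem_union.1 hi with hi | hi <;> rcases Finset.mem_union.1 hj with hj | hj
    · exact s2 i hi j hj hij
    · left; linarith [(s1 i hi).2.1, (t1 j hj).1]
    · right; left; linarith [(s1 j hj).2.1, (t1 i hi).1]
    · exact t2 i hi j hj hij
  · refine .vert _ _ c h0 h1 (fun i hi => ?_) ?_ ?_
    · rcases Finset.mem_union.1 hi with hi | hi
      · exact .inl (s1 i hi).2.1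
      · exact .inr (t1 i hi).1
    · convert s3 using 1
      ext i
      simp only [Finset.mem_filter, Finset.mem_union]
      refine ⟨fun ⟨hi, hc⟩ => hi.resolve_right fun hi => ?_, fun hi => ⟨.inl hi, (s1 i hi).2.1⟩⟩
      linarith [(t1 i hi).1, hw i]
    · convert t3 using 1
      ext i
      simp only [Finset.mem_filter, Finset.mem_union]
      refine ⟨fun ⟨hi, hc⟩ => hi.resolve_left fun hi => hc (s1 i hi).2.1,
        fun hi => ⟨.inr hi, ?_⟩⟩
      linarith [(t1 i hi).1, hw i]

theorem Realizes.stack {ι : Type} [DecidableEq ι] {w h : ι → ℝ} (hh : ∀ i, 0 < h i)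
    {S T : Finset ι} {x₀ y₀ x₁ y₁ c : ℝ} {x y : ι → ℝ} (h0 : y₀ ≤ c) (h1 : c ≤ y₁)
    (HS : Realizes w h S x₀ y₀ x₁ c x y) (HT : Realizes w h T x₀ c x₁ y₁ x y) :
    Realizes w h (S ∪ T) x₀ y₀ x₁ y₁ x y := by
  obtain ⟨s1, s2, s3⟩ := HS
  obtain ⟨t1, t2, t3⟩ := HT
  refine ⟨fun i hi => ?_, fun i hi j hj hij => ?_, ?_⟩
  · rcases Finset.mem_union.1 hi with hi | hi
    · have := s1 i hi; exact ⟨this.1, this.2.1, this.2.2.1, by linarith⟩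
    · have := t1 i hi; exact ⟨this.1, this.2.1, by linarith, this.2.2.2⟩
  · rcases Finset.mem_union.1 hi with hi | hi <;> rcases Finset.mem_union.1 hj with hj | hj
    · exact s2 i hi j hj hij
    · right; right; left; linarith [(s1 i hi).2.2.2, (t1 j hj).2.2.1]
    · right; right; right; linarith [(s1 j hj).2.2.2, (t1 i hi).2.2.1]
    · exact t2 i hi j hj hij
  · refine .horiz _ _ c h0 h1 (fun i hi => ?_) ?_ ?_
    · rcases Finset.mem_union.1 hi with hi | hi
      · exact .inl (s1 i hi).2.2.2
      · exact .inr (t1 i hi).2.2.1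
    · convert s3 using 1
      ext i
      simp only [Finset.mem_filter, Finset.mem_union]
      refine ⟨fun ⟨hi, hc⟩ => hi.resolve_right fun hi => ?_, fun hi => ⟨.inl hi, (s1 i hi).2.2.2⟩⟩
      linarith [(t1 i hi).2.2.1, hh i]
    · convert t3 using 1
      ext i
      simp only [Finset.mem_filter, Finset.mem_union]
      refine ⟨fun ⟨hi, hc⟩ => hi.resolve_left fun hi => hc (s1 i hi).2.2.2,
        fun hi => ⟨.inr hi, ?_⟩⟩
      linarith [(t1 i hi).2.2.1, hh i]

theorem GPack.exists_realizes {ι : Type} [DecidableEq ι] {w h : ι → ℝ} (hw : ∀ i, 0 < w i)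
    (hh : ∀ i, 0 < h i) {S : Finset ι} {a b : ℝ} (H : GPack w h S a b) (x₀ y₀ : ℝ) :
    ∃ x y, Realizes w h S x₀ y₀ (x₀ + a) (y₀ + b) x y := by
  induction H generalizing x₀ y₀ with
  | empty a b ha hb =>
    exact ⟨0, 0, by simp, by simp, .leaf _ _ (by simp)⟩
  | single i a b ha hb =>
    refine ⟨fun _ => x₀, fun _ => y₀, ?_, ?_, .leaf _ _ (by simp)⟩
    · simpa using ⟨ha, hb⟩
    · intro j hj k hk hjk
      exact absurd ((Finset.mem_singleton.1 hj).trans (Finset.mem_singleton.1 hk).symm) hjk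
  | side S T a₁ a₂ b hST hS hT ihS ihT =>
    obtain ⟨x, y, hxy⟩ := ihS x₀ y₀
    obtain ⟨x', y', hxy'⟩ := ihT (x₀ + a₁) y₀
    refine ⟨fun i => if i ∈ S then x i else x' i, fun i => if i ∈ S then y i else y' i, ?_⟩
    have e1 := (hS.nonneg hw hh).1
    have e2 := (hT.nonneg hw hh).1
    refine Realizes.side hw (c := x₀ + a₁) (by linarith) (by linarith) ?_ ?_
    · exact hxy.congr (fun i hi => by simp [hi]) (fun i hi => by simp [hi])
    · rw [← add_assoc]
      exact hxy'.congr (fun i hi => by simp [Finset.disjoint_right.1 hST hi])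
        (fun i hi => by simp [Finset.disjoint_right.1 hST hi])
  | stack S T a b₁ b₂ hST hS hT ihS ihT =>
    obtain ⟨x, y, hxy⟩ := ihS x₀ y₀
    obtain ⟨x', y', hxy'⟩ := ihT x₀ (y₀ + b₁)
    refine ⟨fun i => if i ∈ S then x i else x' i, fun i => if i ∈ S then y i else y' i, ?_⟩
    have e1 := (hS.nonneg hw hh).2
    have e2 := (hT.nonneg hw hh).2
    refine Realizes.stack hh (c := y₀ + b₁) (by linarith) (by linarith) ?_ ?_
    · exact hxy.congr (fun i hi => by simp [hi]) (fun i hi => by simp [hi])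
    · rw [← add_assoc]
      exact hxy'.congr (fun i hi => by simp [Finset.disjoint_right.1 hST hi])
        (fun i hi => by simp [Finset.disjoint_right.1 hST hi])

/-- `Bins w h S N`: the items of `S` have a guillotine packing into `N` unit bins. -/
inductive Bins {ι : Type} [DecidableEq ι] (w h : ι → ℝ) : Finset ι → ℕ → Prop
  | nil : Bins w h ∅ 0
  | cons (S T : Finset ι) (N : ℕ) (hST : Disjoint S T) (hS : Bins w h S N)
      (hT : GPack w h T 1 1) : Bins w h (S ∪ T) (N + 1)

theorem Bins.transpose {ι : Type} [DecidableEq ι] {w h : ι → ℝ} {S : Finset ι} {N : ℕ}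
    (H : Bins w h S N) : Bins h w S N := by
  induction H with
  | nil => exact .nil
  | cons S T N hST _ hT ih => exact .cons _ _ _ hST ih hT.transpose

theorem GPack.bins {ι : Type} [DecidableEq ι] {w h : ι → ℝ} {S : Finset ι}
    (H : GPack w h S 1 1) : Bins w h S 1 := by
  simpa using Bins.cons ∅ S 0 (by simp) .nil H

theorem Bins.union {ι : Type} [DecidableEq ι] {w h : ι → ℝ} {S T : Finset ι} {N M : ℕ}
    (HS : Bins w h S N) (HT : Bins w h T M) (hST : Disjoint S T) : Bins w h (S ∪ T) (N + M) := by
  induction HT with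
  | nil => simpa using HS
  | cons T U M hTU _ hU ih =>
    rw [← Finset.union_assoc, ← Nat.add_assoc]
    rw [Finset.disjoint_union_right] at hST
    exact .cons _ _ _ (by rw [Finset.disjoint_union_left]; exact ⟨hST.2, hTU⟩) (ih hST.1) hU

theorem Bins.exists_assignment {ι : Type} [DecidableEq ι] {w h : ι → ℝ} {S : Finset ι} {N : ℕ}
    (H : Bins w h S N) : ∃ f : ι → ℕ, (∀ i ∈ S, f i < N) ∧
      ∀ b, GPack w h (S.filter fun i => f i = b) 1 1 := by
  induction H with
  | nil => exact ⟨0, by simp, fun b => by simpa using GPack.empty 1 1 (by norm_num) (by norm_num)⟩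
  | cons S T N hST _ hT ih =>
    obtain ⟨f, hf, hG⟩ := ih
    refine ⟨fun i => if i ∈ T then N else f i, fun i hi => ?_, fun b => ?_⟩
    · dsimp only
      split_ifs with hiT
      · omega
      · have := hf i ((Finset.mem_union.1 hi).resolve_right hiT); omega
    · by_cases hb : b = N
      · convert hT using 1
        ext i
        simp only [Finset.mem_filter, Finset.mem_union]
        constructor
        · rintro ⟨hi, hib⟩
          by_contra hiT
          have := hf i (hi.resolve_right hiT)
          simp only [hiT, if_false] at hib
          omega
        · intro hi
          simp [hi, hb]
      · convert hG b using 1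
        ext i
        simp only [Finset.mem_filter, Finset.mem_union]
        constructor
        · rintro ⟨hi, hib⟩
          by_cases hiT : i ∈ T
          · simp only [hiT, if_true] at hib; exact absurd hib.symm hb
          · simp only [hiT, if_false] at hib
            exact ⟨hi.resolve_right hiT, hib⟩
        · rintro ⟨hi, hib⟩
          simp [hi, hib, Finset.disjoint_left.1 hST hi]

theorem Bins.optg_le {n N : ℕ} {w h : Fin n → ℝ} (hw : ∀ i, 0 < w i)
    (hh : ∀ i, 0 < h i) (H : Bins w h Finset.univ N) : optg w h ≤ N := by
  obtain ⟨f, hf, hG⟩ := H.exists_assignment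
  choose x y hxy using fun b => (hG b).exists_realizes hw hh 0 0
  simp only [zero_add] at hxy
  have key : ∀ b, Realizes w h (Finset.univ.filter fun i => f i = b) 0 0 1 1
      (fun i => x (f i) i) (fun i => y (f i) i) := fun b =>
    (hxy b).congr (fun i hi => by rw [(Finset.mem_filter.1 hi).2])
      (fun i hi => by rw [(Finset.mem_filter.1 hi).2])
  have mem : ∀ i, i ∈ Finset.univ.filter fun j => f j = f i := by simp
  refine Nat.sInf_le ⟨⟨fun i => ⟨f i, hf i (Finset.mem_univ i)⟩, fun i => x (f i) i,
    fun i => y (f i) i, fun i => ((key _).1 i (mem i)).1, fun i => ((key _).1 i (mem i)).2.2.1,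
    fun i => ((key _).1 i (mem i)).2.1, fun i => ((key _).1 i (mem i)).2.2.2, ?_⟩, ?_⟩
  · intro i j hij hb
    have hb' : f i = f j := by simpa using hb
    have h2 := (key (f i)).2.1 i (mem i) j (by simp [hb']) hij
    rw [Set.eq_empty_iff_forall_notMem]
    rintro ⟨u, v⟩ ⟨⟨⟨a1, a2⟩, a3, a4⟩, ⟨b1, b2⟩, b3, b4⟩
    dsimp only at a1 a2 a3 a4 b1 b2 b3 b4 h2
    rcases h2 with h2 | h2 | h2 | h2 <;> linarith
  · intro b
    have h3 := (key b).2.2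
    have : (Finset.univ.filter fun i => (⟨f i, hf i (Finset.mem_univ i)⟩ : Fin N) = b)
        = Finset.univ.filter fun i => f i = b := by
      ext i; simp [Fin.ext_iff]
    simp only [this]
    exact h3
/-- Disjoint intervals inside `[0, 1]` have total length at most `1`. -/
theorem sum_length_le_one {ι : Type} (T : Finset ι) (x w : ι → ℝ) (hw : ∀ i ∈ T, 0 ≤ w i)
    (h0 : ∀ i ∈ T, 0 ≤ x i) (h1 : ∀ i ∈ T, x i + w i ≤ 1)
    (hd : ∀ i ∈ T, ∀ j ∈ T, i ≠ j →
      Disjoint (Set.Ioo (x i) (x i + w i)) (Set.Ioo (x j) (x j + w j))) :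
    ∑ i ∈ T, w i ≤ 1 := by
  have e1 : MeasureTheory.volume (⋃ i ∈ T, Set.Ioo (x i) (x i + w i))
      = ∑ i ∈ T, MeasureTheory.volume (Set.Ioo (x i) (x i + w i)) :=
    MeasureTheory.measure_biUnion_finset (fun i hi j hj hij => hd i hi j hj hij)
      (fun i _ => measurableSet_Ioo)
  have e2 : MeasureTheory.volume (⋃ i ∈ T, Set.Ioo (x i) (x i + w i))
      ≤ MeasureTheory.volume (Set.Icc (0 : ℝ) 1) := by
    apply MeasureTheory.measure_mono
    refine Set.iUnion₂_subset fun i hi u hu => ⟨?_, ?_⟩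
    · linarith [h0 i hi, hu.1]
    · linarith [h1 i hi, hu.2]
  rw [e1] at e2
  simp only [Real.volume_Ioo, Real.volume_Icc, add_sub_cancel_left, sub_zero] at e2
  rw [← ENNReal.ofReal_sum_of_nonneg hw] at e2
  exact (ENNReal.ofReal_le_ofReal_iff zero_le_one).1 e2

/-- If no set of items of total width at most `1` has value more than `C`, then the height-weighted
total value is at most `C` per bin. -/
theorem BinPacking.sum_mul_le {ι : Type} [Fintype ι] {w h : ι → ℝ} {N : ℕ}
    (P : BinPacking w h N) (hw : ∀ i, 0 < w i) (hh : ∀ i, 0 < h i) (v : ι → ℝ) (C : ℝ)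
    (hv : ∀ T : Finset ι, ∑ i ∈ T, w i ≤ 1 → ∑ i ∈ T, v i ≤ C) :
    ∑ i, h i * v i ≤ C * N := by
  classical
  have hbin : ∀ b : Fin N, ∑ i ∈ Finset.univ.filter (fun i => P.bin i = b), h i * v i ≤ C := by
    intro b
    set B := Finset.univ.filter (fun i => P.bin i = b) with hB
    set g : ι → ℝ → ℝ := fun i => (Set.Ioo (P.y i) (P.y i + h i)).indicator fun _ => v i with hg
    have hint : ∀ i, MeasureTheory.IntegrableOn (g i) (Set.Icc (0 : ℝ) 1) := fun i =>
      (MeasureTheory.integrableOn_const (by simp)).indicator measurableSet_Ioo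
    have hval : ∀ i, ∫ t in Set.Icc (0 : ℝ) 1, g i t = h i * v i := by
      intro i
      have hsub : Set.Ioo (P.y i) (P.y i + h i) ⊆ Set.Icc (0 : ℝ) 1 := fun t ht =>
        ⟨by linarith [P.y_nonneg i, ht.1], by linarith [P.y_add_le i, ht.2]⟩
      rw [hg, MeasureTheory.setIntegral_indicator measurableSet_Ioo, Set.inter_eq_right.2 hsub]
      simp [MeasureTheory.measureReal_def, (hh i).le]
    have hpt : ∀ t, ∑ i ∈ B, g i t ≤ C := by
      intro t
      have : ∑ i ∈ B, g i t
          = ∑ i ∈ B.filter (fun i => t ∈ Set.Ioo (P.y i) (P.y i + h i)), v i := by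
        rw [Finset.sum_filter (fun i => t ∈ Set.Ioo (P.y i) (P.y i + h i))]
        exact Finset.sum_congr rfl fun i _ => by simp [hg, Set.indicator_apply]
      rw [this]
      apply hv
      refine sum_length_le_one _ P.x w (fun i _ => (hw i).le) (fun i _ => P.x_nonneg i)
        (fun i _ => P.x_add_le i) ?_
      intro i hi j hj hij
      simp only [hB, Finset.mem_filter, Finset.mem_univ, true_and] at hi hj
      have hd := P.disj i j hij (hi.1.trans hj.1.symm)
      rw [Set.disjoint_left]
      intro u hu hu'
      have : (u, t) ∈ (∅ : Set (ℝ × ℝ)) := hd ▸ ⟨⟨hu, hi.2⟩, ⟨hu', hj.2⟩⟩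
      exact this
    calc ∑ i ∈ B, h i * v i = ∫ t in Set.Icc (0 : ℝ) 1, ∑ i ∈ B, g i t := by
          rw [MeasureTheory.integral_finsetSum _ fun i _ => hint i]
          exact Finset.sum_congr rfl fun i _ => (hval i).symm
      _ ≤ ∫ _t in Set.Icc (0 : ℝ) 1, C :=
          MeasureTheory.integral_mono (MeasureTheory.integrable_finsetSum _ fun i _ => hint i)
            (MeasureTheory.integrableOn_const (by simp)) hpt
      _ = C := by simp
  calc ∑ i, h i * v i
      = ∑ b : Fin N, ∑ i ∈ Finset.univ.filter (fun i => P.bin i = b), h i * v i :=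
        (Finset.sum_fiberwise _ _ _).symm
    _ ≤ ∑ _b : Fin N, C := Finset.sum_le_sum fun b _ => hbin b
    _ = C * N := by simp [mul_comm]

/-- Exchanging the two coordinates of a bin packing. -/
def BinPacking.transpose {ι : Type} [Fintype ι] {w h : ι → ℝ} {N : ℕ} (P : BinPacking w h N) :
    BinPacking h w N where
  bin := P.bin
  x := P.y
  y := P.x
  x_nonneg := P.y_nonneg
  y_nonneg := P.x_nonneg
  x_add_le := P.y_add_le
  y_add_le := P.x_add_le
  disj i j hij hb := by
    have hd := P.disj i j hij hb
    rw [Set.eq_empty_iff_forall_notMem] at hd ⊢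
    rintro ⟨u, v⟩ ⟨⟨a1, a2⟩, b1, b2⟩
    exact hd (v, u) ⟨⟨a2, a1⟩, b2, b1⟩

theorem exists_binPacking_opt {n : ℕ} {w h : Fin n → ℝ} (hw : ∀ i, w i ≤ 1)
    (hh : ∀ i, h i ≤ 1) : Nonempty (BinPacking w h (opt w h)) := by
  have hne : {N | Nonempty (BinPacking w h N)}.Nonempty :=
    ⟨n, ⟨⟨id, 0, 0, by simp, by simp, by simpa using hw, by simpa using hh,
      fun i j hij hb => absurd hb hij⟩⟩⟩
  exact Nat.sInf_mem hne
/-- `Block w h S s ρ`: the items of `S` can be arranged in columns of total width `s`, where the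
items in each column have total height at most `ρ`. Columns are named after items bounding their
widths. -/
def Block {ι : Type} [DecidableEq ι] (w h : ι → ℝ) (S : Finset ι) (s ρ : ℝ) : Prop :=
  ∃ (K : Finset ι) (κ : ι → ι), (∀ i ∈ S, κ i ∈ K ∧ w i ≤ w (κ i)) ∧ ∑ k ∈ K, w k ≤ s ∧
    ∀ k ∈ K, ∑ i ∈ S.filter (fun i => κ i = k), h i ≤ ρ

theorem GPack.column {ι : Type} [DecidableEq ι] {w h : ι → ℝ} (T : Finset ι) {c ρ : ℝ}
    (hc : 0 ≤ c) (hT : ∀ i ∈ T, w i ≤ c) (hρ : ∑ i ∈ T, h i ≤ ρ) :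
    GPack w h T c ρ := by
  refine GPack.mono_height ?_ hc hρ
  clear hρ
  induction T using Finset.induction_on with
  | empty => exact .empty _ _ hc (by simp)
  | insert i T hi ih =>
    rw [Finset.sum_insert hi, Finset.insert_eq]
    exact .stack _ _ _ _ _ (by simpa using hi)
      (.single _ _ _ (hT i (by simp)) le_rfl) (ih fun j hj => hT j (by simp [hj]))

theorem Block.gpack {ι : Type} [DecidableEq ι] {w h : ι → ℝ} (hw : ∀ i, 0 < w i)
    (hh : ∀ i, 0 < h i) {S : Finset ι} {s ρ : ℝ} (hρ : 0 ≤ ρ) (H : Block w h S s ρ) :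
    GPack w h S s ρ := by
  obtain ⟨K, κ, h1, h2, h3⟩ := H
  refine GPack.mono_width ?_ hρ h2
  clear h2
  induction K using Finset.induction_on generalizing S with
  | empty =>
    have : S = ∅ := Finset.eq_empty_of_forall_notMem fun i hi => by simpa using (h1 i hi).1
    subst this
    exact .empty _ _ (by simp) hρ
  | insert k K hk ih =>
    rw [Finset.sum_insert hk, ← Finset.filter_union_filter_not_eq (fun i => κ i = k) S]
    refine .side _ _ _ _ _ (Finset.disjoint_filter_filter_not _ _ _) ?_ (ih ?_ ?_)
    · refine GPack.column _ (hw k).le (fun i hi => ?_) (h3 k (by simp))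
      rw [Finset.mem_filter] at hi
      rw [← hi.2]; exact (h1 i hi.1).2
    · intro i hi
      rw [Finset.mem_filter] at hi
      exact ⟨(Finset.mem_insert.1 (h1 i hi.1).1).resolve_left hi.2, (h1 i hi.1).2⟩
    · intro l hl
      refine le_trans (Finset.sum_le_sum_of_subset_of_nonneg ?_ fun i _ _ => (hh i).le)
        (h3 l (by simp [hl]))
      intro i hi
      simp only [Finset.mem_filter] at hi ⊢
      exact ⟨hi.1.1, hi.2⟩

theorem exists_subset_sum_le {ι : Type} [DecidableEq ι] {h : ι → ℝ} {δ : ℝ}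
    (X : Finset ι) (hX : ∀ i ∈ X, h i ≤ δ) {z : ℝ} (hz : 0 ≤ z) :
    ∃ T ⊆ X, ∑ i ∈ T, h i ≤ z ∧ (T = X ∨ z - δ ≤ ∑ i ∈ T, h i) := by
  induction X using Finset.induction_on with
  | empty => exact ⟨∅, by simp, by simpa using hz, by simp⟩
  | insert i X hi ih =>
    obtain ⟨T, hTX, h1, h2⟩ := ih fun j hj => hX j (by simp [hj])
    rcases h2 with rfl | h2
    · by_cases hle : h i + ∑ j ∈ T, h j ≤ z
      · exact ⟨insert i T, subset_rfl, by rwa [Finset.sum_insert hi], .inl rfl⟩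
      · exact ⟨T, Finset.subset_insert _ _, h1, .inr (by linarith [hX i (by simp)])⟩
    · exact ⟨T, hTX.trans (Finset.subset_insert _ _), h1, .inr h2⟩

/-- A horizontal slice of height `z` can be taken off a block so that its height drops by at least
`z - δ`. -/
theorem Block.split {ι : Type} [DecidableEq ι] {w h : ι → ℝ} (hh : ∀ i, 0 < h i) {δ : ℝ}
    {S : Finset ι} (hS : ∀ i ∈ S, h i ≤ δ) {s ρ : ℝ} (H : Block w h S s ρ) {z : ℝ} (hz : 0 ≤ z)
    (hzρ : z - δ ≤ ρ) :
    ∃ T ⊆ S, Block w h T s z ∧ Block w h (S \ T) s (ρ - (z - δ)) := by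
  obtain ⟨K, κ, h1, h2, h3⟩ := H
  choose T hTS hTz hT using fun k => exists_subset_sum_le (S.filter fun i => κ i = k)
    (fun i hi => hS i (Finset.mem_of_mem_filter i hi)) hz
  refine ⟨S.filter fun i => i ∈ T (κ i), Finset.filter_subset _ _, ⟨K, κ, fun i hi =>
    h1 i (Finset.mem_of_mem_filter i hi), h2, fun k hk => ?_⟩, ⟨K, κ, fun i hi =>
    h1 i (Finset.sdiff_subset hi), h2, fun k hk => ?_⟩⟩
  · refine le_trans (Finset.sum_le_sum_of_subset_of_nonneg ?_ fun i _ _ => (hh i).le) (hTz k)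
    intro i hi
    simp only [Finset.mem_filter] at hi
    rw [← hi.2]; exact hi.1.2
  · have hsub : ((S \ S.filter fun i => i ∈ T (κ i)).filter fun i => κ i = k)
        ⊆ (S.filter fun i => κ i = k) \ T k := by
      intro i hi
      simp only [Finset.mem_filter, Finset.mem_sdiff, not_and] at hi ⊢
      refine ⟨⟨hi.1.1, hi.2⟩, ?_⟩
      rw [← hi.2]; exact hi.1.2 hi.1.1
    refine (Finset.sum_le_sum_of_subset_of_nonneg hsub fun i _ _ => (hh i).le).trans ?_
    rcases hT k with hk' | hk'
    · rw [← hk']; simp only [sdiff_self, Finset.bot_eq_empty, Finset.sum_empty]; linarith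
    · have := Finset.sum_sdiff (hTS k) (f := h)
      linarith [h3 k hk]

theorem Block.empty {ι : Type} [DecidableEq ι] (w h : ι → ℝ) {s : ℝ} (hs : 0 ≤ s) (ρ : ℝ) :
    Block w h ∅ s ρ :=
  ⟨∅, id, by simp, by simpa using hs, by simp⟩

/-- A sequence of `n` disjoint blocks of height `1`, of widths in `[1/2, 1]` summing to `φ`. -/
inductive Blocks {ι : Type} [DecidableEq ι] (w h : ι → ℝ) : Finset ι → ℕ → ℝ → Prop
  | nil : Blocks w h ∅ 0 0
  | cons (S T : Finset ι) (n : ℕ) (φ s : ℝ) (hST : Disjoint S T) (hS : Blocks w h S n φ)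
      (hT : Block w h T s 1) (hs : 1 / 2 ≤ s) (hs1 : s ≤ 1) : Blocks w h (S ∪ T) (n + 1) (φ + s)

theorem Blocks.bins {ι : Type} [DecidableEq ι] {w h : ι → ℝ} (hw : ∀ i, 0 < w i)
    (hh : ∀ i, 0 < h i) {S : Finset ι} {n : ℕ} {φ : ℝ} (H : Blocks w h S n φ) :
    Bins w h S n ∧ 0 ≤ φ := by
  induction H with
  | nil => exact ⟨.nil, le_rfl⟩
  | cons S T n φ s hST _ hT hs hs1 ih =>
    exact ⟨.cons _ _ _ hST ih.1 ((hT.gpack hw hh zero_le_one).mono_width zero_le_one hs1),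
      by linarith [ih.2]⟩

/-- A supply of `n` full blocks and one partial block of height `ρ`, of total area `φ`. -/
def Stock {ι : Type} [DecidableEq ι] (w h : ι → ℝ) (S : Finset ι) (n : ℕ) (ρ φ : ℝ) : Prop :=
  ∃ (S₀ S₁ : Finset ι) (s φ₁ : ℝ), S = S₁ ∪ S₀ ∧ Disjoint S₁ S₀ ∧ Block w h S₀ s ρ ∧ 0 ≤ ρ ∧
    ρ ≤ 1 ∧ 1 / 2 ≤ s ∧ s ≤ 1 ∧ Blocks w h S₁ n φ₁ ∧ φ = φ₁ + s * ρ

theorem Stock.bins {ι : Type} [DecidableEq ι] {w h : ι → ℝ} (hw : ∀ i, 0 < w i)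
    (hh : ∀ i, 0 < h i) {S : Finset ι} {n : ℕ} {ρ φ : ℝ} (H : Stock w h S n ρ φ) :
    Bins w h S (n + 1) ∧ 0 ≤ φ ∧ 0 ≤ ρ ∧ ρ ≤ 1 := by
  obtain ⟨S₀, S₁, s, φ₁, rfl, hd, hB, h0, h1, hs, hs1, hBs, rfl⟩ := H
  obtain ⟨hb, hφ⟩ := hBs.bins hw hh
  refine ⟨.cons _ _ _ hd hb ?_, by positivity, h0, h1⟩
  exact ((hB.gpack hw hh h0).mono_width h0 hs1).mono_height zero_le_one h1

theorem Stock.pop {ι : Type} [DecidableEq ι] {w h : ι → ℝ} {S : Finset ι} {n : ℕ} {ρ φ : ℝ}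
    (H : Stock w h S (n + 1) ρ φ) :
    ∃ T ⊆ S, ∃ s, 1 / 2 ≤ s ∧ s ≤ 1 ∧ Block w h T s 1 ∧ Stock w h (S \ T) n ρ (φ - s) := by
  obtain ⟨S₀, S₁, s, φ₁, rfl, hd, hB, h0, h1, hs, hs1, hBs, rfl⟩ := H
  cases hBs with
  | cons S T n φ t hST hS hT ht ht1 =>
    rw [Finset.disjoint_union_left] at hd
    refine ⟨T, fun i hi => by simp [hi], t, ht, ht1, hT, S₀, S, s, φ, ?_, hd.1, hB, h0, h1, hs,
      hs1, hS, by ring⟩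
    ext i
    have a : i ∈ S → i ∉ T := fun hi => Finset.disjoint_left.1 hST hi
    have b : i ∈ T → i ∉ S₀ := fun hi => Finset.disjoint_left.1 hd.2 hi
    simp only [Finset.mem_sdiff, Finset.mem_union]
    tauto

/-- Taking a slab of height `z` off a stock either exhausts it or consumes `z - δ` of its height. -/
theorem Stock.take {ι : Type} [DecidableEq ι] {w h : ι → ℝ} (hw : ∀ i, 0 < w i)
    (hh : ∀ i, 0 < h i) {δ : ℝ} (hδ : 0 ≤ δ) {S : Finset ι} (hS : ∀ i ∈ S, h i ≤ δ) {n : ℕ}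
    {ρ φ : ℝ} (H : Stock w h S n ρ φ) {z : ℝ} (hz : 0 ≤ z) (hz1 : z ≤ 1) :
    (n = 0 ∧ ρ ≤ z ∧ GPack w h S 1 z) ∨
    ∃ T ⊆ S, GPack w h T 1 z ∧ ∃ n' ρ' φ', Stock w h (S \ T) n' ρ' φ' ∧ n' ≤ n ∧
      (n' : ℝ) + ρ' = n + ρ - max (z - δ) 0 ∧ φ' ≤ φ - 1 / 2 * max (z - δ) 0 := by
  by_cases hzδ : z ≤ δ
  · right
    refine ⟨∅, by simp, .empty _ _ zero_le_one hz, n, ρ, φ, by simpa using H, le_rfl, ?_, ?_⟩ <;>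
      simp [max_eq_right (sub_nonpos.2 hzδ)]
  push Not at hzδ
  rw [max_eq_left (sub_nonneg.2 hzδ.le)]
  obtain ⟨S₀, S₁, s, φ₁, rfl, hd, hB, h0, h1, hs, hs1, hBs, rfl⟩ := H
  by_cases hρ : z - δ ≤ ρ
  · right
    obtain ⟨T, hTS, hT, hR⟩ := hB.split hh (fun i hi => hS i (by simp [hi])) hz hρ
    refine ⟨T, hTS.trans Finset.subset_union_right, (hT.gpack hw hh hz).mono_width hz hs1, n,
      ρ - (z - δ), φ₁ + s * (ρ - (z - δ)), ⟨S₀ \ T, S₁, s, φ₁, ?_,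
        hd.mono_right Finset.sdiff_subset, hR, by linarith, by linarith, hs, hs1, hBs, rfl⟩,
      le_rfl, by ring, by nlinarith⟩
    rw [Finset.union_sdiff_distrib, Finset.sdiff_eq_self_of_disjoint (hd.mono_right hTS)]
  · push Not at hρ
    have hG₀ : GPack w h S₀ 1 ρ := (hB.gpack hw hh h0).mono_width h0 hs1
    cases hBs with
    | nil =>
      left
      refine ⟨rfl, by linarith, ?_⟩
      simpa using hG₀.mono_height zero_le_one (by linarith : ρ ≤ z)
    | cons S T n φ t hST hS' hT ht ht1 =>
      right
      rw [Finset.disjoint_union_left] at hd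
      obtain ⟨U, hUT, hU, hR⟩ := hT.split hh (δ := δ) (fun i hi => hS i (by simp [hi]))
        (z := z - ρ) (by linarith) (by linarith)
      refine ⟨S₀ ∪ U, ?_, ?_, n, 1 - (z - ρ - δ), φ + t * (1 - (z - ρ - δ)),
        ⟨T \ U, S, t, φ, ?_, hST.mono_right Finset.sdiff_subset, hR, by linarith, by linarith, ht,
          ht1, hS', rfl⟩, by omega, by push_cast; ring, ?_⟩
      · intro i hi
        have := @hUT i
        simp only [Finset.mem_union] at hi ⊢
        tauto
      · have := GPack.stack _ _ _ _ _ (hd.2.symm.mono_right hUT) hG₀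
          ((hU.gpack hw hh (by linarith)).mono_width (by linarith) ht1)
        simpa using this
      · ext i
        have a : i ∈ S → i ∉ T := fun hi => Finset.disjoint_left.1 hST hi
        have b : i ∈ S → i ∉ S₀ := fun hi => Finset.disjoint_left.1 hd.1 hi
        have c : i ∈ T → i ∉ S₀ := fun hi => Finset.disjoint_left.1 hd.2 hi
        have d := @hUT i
        simp only [Finset.mem_sdiff, Finset.mem_union]
        tauto
      · nlinarith
/-- One bin that combines a full block of a stock of wide items with a slab of a stock of tall
items. -/
theorem Stock.combine {ι : Type} [DecidableEq ι] {w h : ι → ℝ} (hw : ∀ i, 0 < w i)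
    (hh : ∀ i, 0 < h i) {δ : ℝ} (hδ : 0 ≤ δ) {S S' : Finset ι}
    (hS' : ∀ i ∈ S', w i ≤ δ) (hd : Disjoint S S') {n m : ℕ} {ρ φ ρ' φ' : ℝ}
    (H : Stock w h S (n + 1) ρ φ) (H' : Stock h w S' m ρ' φ') :
    ∃ T ⊆ S, ∃ φ₁, Stock w h (S \ T) n ρ φ₁ ∧
      ((m = 0 ∧ ρ' ≤ 1 / 2 ∧ GPack w h (T ∪ S') 1 1) ∨
      ∃ T' ⊆ S', GPack w h (T ∪ T') 1 1 ∧ ∃ m₁ ρ₁ φ₁', Stock h w (S' \ T') m₁ ρ₁ φ₁' ∧ m₁ ≤ m ∧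
        (m₁ : ℝ) + ρ₁ ≤ m + ρ' ∧ (m : ℝ) + ρ' ≤ m₁ + ρ₁ + 1 ∧
        φ₁ + φ₁' ≤ φ + φ' - (3 / 4 - δ / 2)) := by
  obtain ⟨T, hTS, s, hs, hs1, hT, hR⟩ := H.pop
  have hTG : GPack w h T s 1 := hT.gpack hw hh zero_le_one
  refine ⟨T, hTS, φ - s, hR, ?_⟩
  rcases H'.take hh hw hδ hS' (sub_nonneg.2 hs1) (by linarith) with
    ⟨hm, hρ, hG⟩ | ⟨T', hT'S, hG, m₁, ρ₁, φ₁', hst, hm, hρ, hφ⟩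
  · left
    refine ⟨hm, by linarith, ?_⟩
    have := GPack.side _ _ _ _ _ (hd.mono_left hTS) hTG hG.transpose
    simpa using this
  · right
    refine ⟨T', hT'S, ?_, m₁, ρ₁, φ₁', hst, hm, ?_, ?_, ?_⟩
    · have := GPack.side _ _ _ _ _ (hd.mono hTS hT'S) hTG hG.transpose
      simpa using this
    · linarith [le_max_right (1 - s - δ) 0]
    · have : max (1 - s - δ) 0 ≤ 1 := max_le (by linarith) zero_le_one
      linarith
    · rcases le_total (1 - s - δ) 0 with hc | hc
      · rw [max_eq_right hc] at hφ; linarith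
      · rw [max_eq_left hc] at hφ; linarith

theorem Bins.absorb {ι : Type} [DecidableEq ι] {w h : ι → ℝ} {S S' T T' : Finset ι} {N : ℕ}
    (hT : T ⊆ S) (hT' : T' ⊆ S') (hd : Disjoint S S') (hN : Bins w h ((S \ T) ∪ (S' \ T')) N)
    (hG : GPack w h (T ∪ T') 1 1) : Bins w h (S ∪ S') (N + 1) := by
  have hdis : ∀ i, i ∈ S → i ∉ S' := fun i hi => Finset.disjoint_left.1 hd hi
  have := Bins.cons _ _ _ (Finset.disjoint_left.2 fun i hi => ?_) hN hG
  · convert this using 1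
    ext i
    have a := @hT i
    have b := @hT' i
    have c := hdis i
    simp only [Finset.mem_sdiff, Finset.mem_union]
    tauto
  · have a := @hT i
    have b := @hT' i
    have c := hdis i
    simp only [Finset.mem_sdiff, Finset.mem_union] at hi ⊢
    tauto

/-- If two stocks have nearly the same height, they can be packed with little waste. -/
theorem Stock.mix_balanced {ι : Type} [DecidableEq ι] {δ : ℝ} (hδ : 0 ≤ δ) (hδ' : δ ≤ 1 / 2)
    (k : ℕ) (w h : ι → ℝ) (hw : ∀ i, 0 < w i) (hh : ∀ i, 0 < h i) (S S' : Finset ι)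
    (hS : ∀ i ∈ S, h i ≤ δ) (hS' : ∀ i ∈ S', w i ≤ δ) (hd : Disjoint S S') (n m : ℕ)
    (ρ φ ρ' φ' : ℝ) (H : Stock w h S n ρ φ) (H' : Stock h w S' m ρ' φ') (hk : n + m ≤ k)
    (hbal : |(n : ℝ) + ρ - (m + ρ')| ≤ 1) :
    ∃ N, Bins w h (S ∪ S') N ∧ (N : ℝ) * (3 / 4 - δ / 2) ≤ φ + φ' + 4 * (3 / 4 - δ / 2) := by
  induction k generalizing w h S S' n m ρ φ ρ' φ' with
  | zero =>
    obtain ⟨b1, b2, b3, b4⟩ := H.bins hw hh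
    obtain ⟨c1, c2, c3, c4⟩ := H'.bins hh hw
    obtain rfl : n = 0 := by omega
    obtain rfl : m = 0 := by omega
    exact ⟨_, b1.union c1.transpose hd, by push_cast; linarith⟩
  | succ k ih =>
    have main : ∀ (w h : ι → ℝ) (hw : ∀ i, 0 < w i) (hh : ∀ i, 0 < h i) (S S' : Finset ι)
        (hS : ∀ i ∈ S, h i ≤ δ) (hS' : ∀ i ∈ S', w i ≤ δ) (hd : Disjoint S S') (n m : ℕ)
        (ρ φ ρ' φ' : ℝ) (H : Stock w h S n ρ φ) (H' : Stock h w S' m ρ' φ') (hk : n + m ≤ k + 1)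
        (hbal : (n : ℝ) + ρ ≤ m + ρ' + 1) (hle : (m : ℝ) + ρ' ≤ n + ρ),
        ∃ N, Bins w h (S ∪ S') N ∧
          (N : ℝ) * (3 / 4 - δ / 2) ≤ φ + φ' + 4 * (3 / 4 - δ / 2) := by
      clear * - ih hδ hδ'
      intro w h hw hh S S' hS hS' hd n m ρ φ ρ' φ' H H' hk hbal hle
      obtain ⟨b1, b2, b3, b4⟩ := H.bins hw hh
      obtain ⟨c1, c2, c3, c4⟩ := H'.bins hh hw
      rcases n with _ | n
      · have hm : m ≤ 1 := by
          have : (m : ℝ) ≤ 1 := by push_cast at hle; linarith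
          exact_mod_cast this
        refine ⟨_, b1.union c1.transpose hd, ?_⟩
        have : ((0 + 1 + (m + 1) : ℕ) : ℝ) ≤ 4 := by
          exact_mod_cast (by omega : 0 + 1 + (m + 1) ≤ 4)
        nlinarith
      · obtain ⟨T, hTS, φ₁, hst, ⟨rfl, hρ', hG⟩ | ⟨T', hT'S, hG, m₁, ρ₁, φ₁', hst', hm, e1, e2, e3⟩⟩ :=
          H.combine hw hh hδ hS' hd H'
        · obtain ⟨d1, d2, d3, d4⟩ := hst.bins hw hh
          have hn : n = 0 := by
            have : (n : ℝ) < 1 := by push_cast at hbal; linarith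
            have : n < 1 := by exact_mod_cast this
            omega
          subst hn
          refine ⟨_, Bins.absorb hTS subset_rfl hd (by simpa using d1) hG, ?_⟩
          push_cast
          linarith
        · obtain ⟨N, hN, hN'⟩ := ih w h hw hh (S \ T) (S' \ T')
            (fun i hi => hS i (Finset.sdiff_subset hi)) (fun i hi => hS' i (Finset.sdiff_subset hi))
            (hd.mono Finset.sdiff_subset Finset.sdiff_subset) n m₁ ρ φ₁ ρ₁ φ₁' hst hst' (by omega)
            (by push_cast at hbal hle; rw [abs_le]; constructor <;> linarith)
          exact ⟨N + 1, Bins.absorb hTS hT'S hd hN hG, by push_cast; linarith⟩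
    rw [abs_le] at hbal
    rcases le_total ((m : ℝ) + ρ') (n + ρ) with hle | hle
    · exact main w h hw hh S S' hS hS' hd n m ρ φ ρ' φ' H H' hk (by linarith) hle
    · obtain ⟨N, hN, hN'⟩ := main h w hh hw S' S hS' hS hd.symm m n ρ' φ' ρ φ H' H (by omega)
        (by linarith) hle
      exact ⟨N, by rw [Finset.union_comm]; exact hN.transpose, by linarith⟩

/-- Packing two stocks, the first of which is at least as high as the second. -/
theorem Stock.mix_of_le {ι : Type} [DecidableEq ι] {δ : ℝ} (hδ : 0 ≤ δ) (hδ' : δ ≤ 1 / 2)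
    {w h : ι → ℝ} (hw : ∀ i, 0 < w i) (hh : ∀ i, 0 < h i) (S S' : Finset ι)
    (hS : ∀ i ∈ S, h i ≤ δ) (hS' : ∀ i ∈ S', w i ≤ δ) (hd : Disjoint S S') (n m : ℕ)
    (ρ φ ρ' φ' : ℝ) (H : Stock w h S n ρ φ) (H' : Stock h w S' m ρ' φ')
    (hle : (m : ℝ) + ρ' ≤ n + ρ) :
    ∃ N, Bins w h (S ∪ S') N ∧
      ((N : ℝ) * (3 / 4 - δ / 2) ≤ φ + φ' + 4 * (3 / 4 - δ / 2) ∨ N ≤ n + 1) := by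
  induction n generalizing S S' m φ ρ' φ' with
  | zero =>
    obtain ⟨b1, b2, b3, b4⟩ := H.bins hw hh
    obtain ⟨c1, c2, c3, c4⟩ := H'.bins hh hw
    obtain ⟨N, hN, hN'⟩ := mix_balanced hδ hδ' _ w h hw hh S S' hS hS' hd 0 m ρ φ ρ' φ' H H' le_rfl
      (by
        push_cast at hle ⊢
        have : (0 : ℝ) ≤ m := m.cast_nonneg
        rw [abs_le]; constructor <;> linarith)
    exact ⟨N, hN, .inl hN'⟩
  | succ n ih =>
    by_cases hbal : (n + 1 : ℕ) + ρ ≤ m + ρ' + 1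
    · obtain ⟨N, hN, hN'⟩ := mix_balanced hδ hδ' _ w h hw hh S S' hS hS' hd _ m ρ φ ρ' φ' H H'
        le_rfl (by rw [abs_le]; constructor <;> linarith)
      exact ⟨N, hN, .inl hN'⟩
    · obtain ⟨T, hTS, φ₁, hst, ⟨rfl, hρ', hG⟩ | ⟨T', hT'S, hG, m₁, ρ₁, φ₁', hst', hm, e1, e2, e3⟩⟩ :=
        H.combine hw hh hδ hS' hd H'
      · obtain ⟨d1, d2, d3, d4⟩ := hst.bins hw hh
        exact ⟨_, Bins.absorb hTS subset_rfl hd (by simpa using d1) hG, .inr le_rfl⟩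
      · obtain ⟨N, hN, hN'⟩ := ih (S \ T) (S' \ T')
          (fun i hi => hS i (Finset.sdiff_subset hi)) (fun i hi => hS' i (Finset.sdiff_subset hi))
          (hd.mono Finset.sdiff_subset Finset.sdiff_subset) m₁ φ₁ ρ₁ φ₁' hst hst'
          (by push_cast at hbal; linarith)
        refine ⟨N + 1, Bins.absorb hTS hT'S hd hN hG, ?_⟩
        rcases hN' with hN' | hN'
        · left; push_cast; linarith
        · right; omega
/-- `Fits a J n`: the numbers `a j`, `j ∈ J`, can be split into `n` groups of sum at most `1`. -/
def Fits {α : Type} [DecidableEq α] (a : α → ℝ) (J : Finset α) (n : ℕ) : Prop :=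
  ∃ f : α → ℕ, (∀ j ∈ J, f j < n) ∧ ∀ b, ∑ j ∈ J.filter (fun j => f j = b), a j ≤ 1

theorem Fits.union {α : Type} [DecidableEq α] {a : α → ℝ} {J K : Finset α} {n m : ℕ}
    (HJ : Fits a J n) (HK : Fits a K m) (hd : Disjoint J K) : Fits a (J ∪ K) (n + m) := by
  obtain ⟨f, hf, hf'⟩ := HJ
  obtain ⟨g, hg, hg'⟩ := HK
  have hJK : ∀ j, j ∈ K → j ∉ J := fun j hj => Finset.disjoint_right.1 hd hj
  refine ⟨fun j => if j ∈ J then f j else n + g j, fun j hj => ?_, fun b => ?_⟩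
  · dsimp only
    split_ifs with h
    · have := hf j h; omega
    · have := hg j ((Finset.mem_union.1 hj).resolve_left h); omega
  · by_cases hb : b < n
    · convert hf' b using 2
      ext j
      simp only [Finset.mem_filter, Finset.mem_union]
      by_cases h : j ∈ J
      · simp [h]
      · simp only [h, if_false, false_or, false_and, iff_false, not_and]
        intro _; omega
    · convert hg' (b - n) using 2
      ext j
      simp only [Finset.mem_filter, Finset.mem_union]
      by_cases h : j ∈ J
      · have := hf j h
        have h' : j ∉ K := fun h' => hJK j h' h
        simp only [h, h', if_true, true_or, true_and, false_and, iff_false]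
        omega
      · simp only [h, if_false, false_or]
        exact and_congr_right fun _ => by omega

theorem Fits.of_sum_le {α : Type} [DecidableEq α] {a : α → ℝ} {J : Finset α}
    (hJ : ∑ j ∈ J, a j ≤ 1) : Fits a J 1 := by
  refine ⟨0, by simp, fun b => ?_⟩
  by_cases hb : 0 = b
  · simpa [hb] using hJ
  · simp [hb]

theorem Fits.of_le_div {α : Type} [DecidableEq α] {a : α → ℝ} {k : ℕ} (hk : 0 < k)
    (J : Finset α) (hJ : ∀ j ∈ J, a j ≤ 1 / k) : Fits a J (J.card / k + 1) := by
  have hk' : (0 : ℝ) < k := by exact_mod_cast hk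
  induction hc : J.card using Nat.strong_induction_on generalizing J with
  | _ c ih =>
    have hsmall : ∀ T ⊆ J, T.card ≤ k → ∑ j ∈ T, a j ≤ 1 := fun T hT hTk =>
      calc ∑ j ∈ T, a j ≤ ∑ _j ∈ T, (1 / k : ℝ) := Finset.sum_le_sum fun j hj => hJ j (hT hj)
        _ = T.card / k := by rw [Finset.sum_const, nsmul_eq_mul]; ring
        _ ≤ 1 := by rw [div_le_one hk']; exact_mod_cast hTk
    by_cases hck : c < k
    · rw [Nat.div_eq_of_lt hck]
      exact .of_sum_le (hsmall J subset_rfl (by omega))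
    · obtain ⟨T, hT, hTc⟩ := Finset.exists_subset_card_eq (show k ≤ J.card by omega)
      have hcard : (J \ T).card = c - k := by rw [Finset.card_sdiff_of_subset hT, hTc, hc]
      have := (ih (c - k) (by omega) (J \ T) (fun j hj => hJ j (Finset.sdiff_subset hj)) hcard).union
        (.of_sum_le (hsmall T hT hTc.le)) Finset.sdiff_disjoint
      rw [Finset.sdiff_union_of_subset hT] at this
      convert this using 1
      rw [Nat.div_eq_sub_div hk (by omega)]

/-- Adding numbers of size at most `1/4` greedily: new groups are opened only when all present
groups have sum at least `3/4`. -/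
theorem Fits.add_small {α : Type} [DecidableEq α] {a : α → ℝ} {J : Finset α} {n : ℕ}
    (HJ : Fits a J n) (K : Finset α) (hd : Disjoint J K) (hK : ∀ j ∈ K, a j ≤ 1 / 4)
    (h0 : ∀ j ∈ K, 0 ≤ a j) :
    ∃ m, Fits a (J ∪ K) m ∧ (m = n ∨ (m : ℝ) * (3 / 4) ≤ ∑ j ∈ J ∪ K, a j + 3 / 4) := by
  induction K using Finset.induction_on with
  | empty => exact ⟨n, by simpa using HJ, .inl rfl⟩
  | insert k K hk ih =>
    rw [Finset.disjoint_insert_right] at hd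
    obtain ⟨m, ⟨f, hf, hf'⟩, hm⟩ := ih hd.2 (fun j hj => hK j (by simp [hj]))
      (fun j hj => h0 j (by simp [hj]))
    have hkJ : k ∉ J ∪ K := by simp [hk, hd.1]
    rw [Finset.union_insert, Finset.sum_insert hkJ]
    have hk4 := hK k (by simp)
    have hk0 := h0 k (by simp)
    have hfilter : ∀ b c, (insert k (J ∪ K)).filter (fun j => (if j = k then c else f j) = b)
        = if c = b then insert k ((J ∪ K).filter fun j => f j = b)
          else (J ∪ K).filter fun j => f j = b := by
      intro b c
      ext j
      by_cases hj : j = k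
      · subst hj
        split_ifs with h <;> simp [h, hd.1, hk]
      · split_ifs with h <;> simp [hj]
    by_cases hex : ∃ b < m, ∑ j ∈ (J ∪ K).filter (fun j => f j = b), a j ≤ 3 / 4
    · obtain ⟨c, hcm, hc⟩ := hex
      refine ⟨m, ⟨fun j => if j = k then c else f j, fun j hj => ?_, fun b => ?_⟩, ?_⟩
      · dsimp only
        split_ifs with h
        · exact hcm
        · exact hf j ((Finset.mem_insert.1 hj).resolve_left h)
      · rw [hfilter]
        split_ifs with h
        · rw [Finset.sum_insert (by simp [hd.1, hk]), ← h]; linarith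
        · exact hf' b
      · rcases hm with hm | hm
        · exact .inl hm
        · right; linarith
    · push Not at hex
      refine ⟨m + 1, ⟨fun j => if j = k then m else f j, fun j hj => ?_, fun b => ?_⟩, .inr ?_⟩
      · dsimp only
        split_ifs with h
        · omega
        · have := hf j ((Finset.mem_insert.1 hj).resolve_left h); omega
      · rw [hfilter]
        split_ifs with h
        · have hem : (J ∪ K).filter (fun j => f j = b) = ∅ :=
            Finset.filter_eq_empty_iff.2 fun j hj hjb => by have := hf j hj; omega
          rw [hem, Finset.sum_insert (by simp), Finset.sum_empty]; linarith
        · exact hf' b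
      · have : (m : ℝ) * (3 / 4) ≤ ∑ j ∈ J ∪ K, a j :=
          calc (m : ℝ) * (3 / 4) = ∑ _b ∈ Finset.range m, (3 / 4 : ℝ) := by simp
            _ ≤ ∑ b ∈ Finset.range m, ∑ j ∈ (J ∪ K).filter (fun j => f j = b), a j :=
              Finset.sum_le_sum fun b hb => (hex b (Finset.mem_range.1 hb)).le
            _ = ∑ j ∈ J ∪ K, a j :=
              Finset.sum_fiberwise_of_maps_to (fun j hj => Finset.mem_range.2 (hf j hj)) _
        push_cast; linarith

/-- A maximal family of disjoint pairs from `L × P` of sum at most `1`. -/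
theorem exists_maximal_pairs {α : Type} [DecidableEq α] (a : α → ℝ) (L P : Finset α)
    (hd : Disjoint L P) :
    ∃ L₁ ⊆ L, ∃ P₁ ⊆ P, L₁.card = P₁.card ∧ Fits a (L₁ ∪ P₁) L₁.card ∧
      ∀ l ∈ L \ L₁, ∀ p ∈ P \ P₁, 1 < a l + a p := by
  induction hc : L.card generalizing L P with
  | zero =>
    rw [Finset.card_eq_zero] at hc
    subst hc
    exact ⟨∅, subset_rfl, ∅, by simp, rfl, ⟨0, by simp, by simp⟩, by simp⟩
  | succ c ih =>
    by_cases hex : ∃ l ∈ L, ∃ p ∈ P, a l + a p ≤ 1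
    · obtain ⟨l, hl, p, hp, hlp⟩ := hex
      obtain ⟨L₁, hL, P₁, hP, h1, h2, h3⟩ := ih (L.erase l) (P.erase p)
        (hd.mono (Finset.erase_subset _ _) (Finset.erase_subset _ _))
        (by rw [Finset.card_erase_of_mem hl]; omega)
      have hlL : l ∉ L₁ := fun h => by simpa using hL h
      have hpP : p ∉ P₁ := fun h => by simpa using hP h
      have hl' : l ∉ P := Finset.disjoint_left.1 hd hl
      have hp' : p ∉ L := Finset.disjoint_right.1 hd hp
      have hne : l ≠ p := fun h => hl' (h ▸ hp)
      have hL' := hL.trans (Finset.erase_subset _ _)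
      have hP' := hP.trans (Finset.erase_subset _ _)
      refine ⟨insert l L₁, Finset.insert_subset hl hL', insert p P₁, Finset.insert_subset hp hP',
        ?_, ?_, ?_⟩
      · rw [Finset.card_insert_of_notMem hlL, Finset.card_insert_of_notMem hpP, h1]
      · rw [Finset.card_insert_of_notMem hlL]
        have := h2.union (K := {l, p}) (.of_sum_le (by rwa [Finset.sum_pair hne])) (by
          simp only [Finset.disjoint_left, Finset.mem_union, Finset.mem_insert,
            Finset.mem_singleton]
          rintro x (hx | hx) (rfl | rfl)
          · exact hlL hx
          · exact hp' (hL' hx)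
          · exact hl' (hP' hx)
          · exact hpP hx)
        convert this using 1
        ext x
        simp only [Finset.mem_union, Finset.mem_insert, Finset.mem_singleton]
        tauto
      · intro x hx y hy
        simp only [Finset.mem_sdiff, Finset.mem_insert, not_or] at hx hy
        exact h3 x (by simp [hx]) y (by simp [hy])
    · push Not at hex
      exact ⟨∅, by simp, ∅, by simp, rfl, ⟨0, by simp, by simp⟩,
        fun l hl p hp => hex l (by simpa using hl) p (by simpa using hp)⟩

/-- The weights of numbers of total sum at most `1` sum to at most `4/3`, if numbers above `1/2`
have weight at most `5/6`, or at most `7/6` if of type `U`, numbers in `(1/4, 1/2]` have weight at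
most `1/6`, or at most `1/2` (above `1/3`) and `1/3` (up to `1/3`) if of type `V`, and no number of
type `U` fits together with one of type `V`. -/
theorem sum_weight_le {ι : Type} [DecidableEq ι] (T : Finset ι) (b v : ι → ℝ) (U V : ι → Prop)
    (h0 : ∀ i ∈ T, 0 < b i)
    (hL : ∀ i ∈ T, 1 / 2 < b i → v i ≤ 5 / 6 ∨ U i ∧ v i ≤ 7 / 6)
    (hP : ∀ i ∈ T, 1 / 4 < b i → b i ≤ 1 / 2 →
      v i ≤ 1 / 6 ∨ V i ∧ v i ≤ 1 / 2 ∧ (1 / 3 < b i ∨ v i ≤ 1 / 3))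
    (hZ : ∀ i ∈ T, b i ≤ 1 / 4 → v i = 0)
    (hUV : ∀ i ∈ T, ∀ j ∈ T, U i → V j → 1 < b i + b j)
    (hb : ∑ i ∈ T, b i ≤ 1) : ∑ i ∈ T, v i ≤ 4 / 3 := by
  set B := T.filter fun i => 1 / 4 < b i with hB
  have hBT : B ⊆ T := Finset.filter_subset _ _
  have hB4 : ∀ i ∈ B, 1 / 4 < b i := fun i hi => (Finset.mem_filter.1 hi).2
  have hv : ∑ i ∈ T, v i = ∑ i ∈ B, v i := by
    refine (Finset.sum_subset hBT fun i hi hi' => hZ i hi ?_).symm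
    by_contra! h
    exact hi' (by simp only [hB, Finset.mem_filter]; exact ⟨hi, h⟩)
  have hbB : ∑ i ∈ B, b i ≤ 1 :=
    (Finset.sum_le_sum_of_subset_of_nonneg hBT fun i hi _ => (h0 i hi).le).trans hb
  have hcard : ∀ C ⊆ B, (C.card : ℝ) * (1 / 4) ≤ ∑ i ∈ C, b i := fun C hC => by
    rw [← nsmul_eq_mul]
    exact Finset.card_nsmul_le_sum _ _ _ fun i hi => (hB4 i (hC hi)).le
  rw [hv]
  by_cases hex : ∃ i ∈ B, 1 / 2 < b i
  · obtain ⟨i, hi, hi2⟩ := hex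
    rw [← Finset.add_sum_erase B _ hi] at hbB ⊢
    have hc := hcard (B.erase i) (Finset.erase_subset _ _)
    have hc1 : (B.erase i).card ≤ 1 := by
      have : ((B.erase i).card : ℝ) < 2 := by linarith
      have : (B.erase i).card < 2 := by exact_mod_cast this
      omega
    have hLi := hL i (hBT hi) hi2
    rcases Nat.le_one_iff_eq_zero_or_eq_one.1 hc1 with hc0 | hc0
    · rw [Finset.card_eq_zero.1 hc0, Finset.sum_empty]
      rcases hLi with h | h <;> linarith
    · obtain ⟨j, hj⟩ := Finset.card_eq_one.1 hc0
      have hjB : j ∈ B := Finset.erase_subset i B (by simp [hj])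
      rw [hj, Finset.sum_singleton] at hbB ⊢
      rcases hP j (hBT hjB) (hB4 j hjB) (by linarith) with h | ⟨hV, h, -⟩
      · rcases hLi with h' | h' <;> linarith
      · rcases hLi with h' | ⟨hU, -⟩
        · linarith
        · linarith [hUV i (hBT hi) j (hBT hjB) hU hV]
  · push Not at hex
    have hv2 : ∀ i ∈ B, v i ≤ 1 / 2 := fun i hi => by
      rcases hP i (hBT hi) (hB4 i hi) (hex i hi) with h | h <;> linarith
    have hvc : ∀ C ⊆ B, ∑ i ∈ C, v i ≤ C.card * (1 / 2) := fun C hC => by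
      rw [← nsmul_eq_mul]
      exact Finset.sum_le_card_nsmul _ _ _ fun i hi => hv2 i (hC hi)
    by_cases hc : B.card ≤ 2
    · have : (B.card : ℝ) ≤ 2 := by exact_mod_cast hc
      linarith [hvc B subset_rfl]
    · push Not at hc
      have hc3 : (3 : ℝ) ≤ B.card := by exact_mod_cast hc
      by_cases h3 : ∃ i ∈ B, b i ≤ 1 / 3
      · obtain ⟨i, hi, hi3⟩ := h3
        have hvi : v i ≤ 1 / 3 := by
          rcases hP i (hBT hi) (hB4 i hi) (hex i hi) with h | ⟨-, -, h | h⟩ <;> linarith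
        have hlt : ∑ _i ∈ B, (1 / 4 : ℝ) < ∑ i ∈ B, b i :=
          Finset.sum_lt_sum_of_nonempty ⟨i, hi⟩ hB4
        rw [Finset.sum_const, nsmul_eq_mul] at hlt
        have hc4 : (B.card : ℝ) < 4 := by linarith
        have hc4 : B.card < 4 := by exact_mod_cast hc4
        have hce : (B.erase i).card = 2 := by rw [Finset.card_erase_of_mem hi]; omega
        have := hvc (B.erase i) (Finset.erase_subset _ _)
        rw [hce] at this
        rw [← Finset.add_sum_erase B _ hi]
        push_cast at this
        linarith
      · push Not at h3
        have hlt : ∑ _i ∈ B, (1 / 3 : ℝ) < ∑ i ∈ B, b i :=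
          Finset.sum_lt_sum_of_nonempty (Finset.card_pos.1 (by omega)) h3
        rw [Finset.sum_const, nsmul_eq_mul] at hlt
        linarith

/-- One-dimensional bin packing by weights: numbers in `(0, 1]` fit into few groups compared with a
weight function that is at most `4/3` on every group of sum at most `1`. -/
theorem exists_fits_weight {α : Type} [DecidableEq α] (a : α → ℝ) (J : Finset α)
    (h0 : ∀ j ∈ J, 0 < a j) (h1 : ∀ j ∈ J, a j ≤ 1) :
    ∃ (m : ℕ) (ω : α → ℝ), Fits a J m ∧ (m : ℝ) ≤ ∑ j ∈ J, ω j + 3 ∧ (∀ j ∈ J, 0 ≤ ω j) ∧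
      ∀ {ι : Type} [DecidableEq ι] (T : Finset ι) (g : ι → α), (∀ i ∈ T, g i ∈ J) →
        ∑ i ∈ T, a (g i) ≤ 1 → ∑ i ∈ T, ω (g i) ≤ 4 / 3 := by
  set L := J.filter fun j => 1 / 2 < a j with hL
  set P := J.filter fun j => 1 / 4 < a j ∧ a j ≤ 1 / 2 with hP
  set Z := J.filter fun j => a j ≤ 1 / 4 with hZ
  have hLP : Disjoint L P := by
    rw [Finset.disjoint_filter]; intro j _ h; push Not; intro _; exact h
  obtain ⟨L₁, hL₁, P₁, hP₁, hcard, hfit, hmax⟩ := exists_maximal_pairs a L P hLP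
  set M := (P \ P₁).filter fun j => 1 / 3 < a j with hM
  set Q := (P \ P₁).filter fun j => ¬ 1 / 3 < a j with hQ
  have hLJ : L ⊆ J := Finset.filter_subset _ _
  have hPJ : P ⊆ J := Finset.filter_subset _ _
  have hMP : M ⊆ P := (Finset.filter_subset _ _).trans Finset.sdiff_subset
  have hQP : Q ⊆ P := (Finset.filter_subset _ _).trans Finset.sdiff_subset
  have hfit2 : Fits a (L \ L₁) ((L \ L₁).card / 1 + 1) :=
    .of_le_div one_pos _ fun j hj => by simpa using h1 j (hLJ (Finset.sdiff_subset hj))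
  have hfit3 : Fits a M (M.card / 2 + 1) := .of_le_div two_pos _ fun j hj => by
    have := (Finset.mem_filter.1 (hMP hj)).2.2
    simpa using this
  have hfit4 : Fits a Q (Q.card / 3 + 1) := .of_le_div three_pos _ fun j hj => by
    have := (Finset.mem_filter.1 hj).2
    push Not at this
    simpa using this
  have hMQ : M ∪ Q = P \ P₁ := Finset.filter_union_filter_not_eq _ _
  have hbase := (hfit.union hfit2 (by
      rw [Finset.disjoint_union_left]
      exact ⟨Finset.disjoint_sdiff, (hLP.mono Finset.sdiff_subset hP₁).symm⟩)).union
    (hfit3.union hfit4 (Finset.disjoint_filter_filter_not _ _ _)) (by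
      rw [hMQ, Finset.disjoint_union_left, Finset.disjoint_union_left]
      exact ⟨⟨hLP.mono hL₁ Finset.sdiff_subset, Finset.disjoint_sdiff⟩,
        hLP.mono Finset.sdiff_subset Finset.sdiff_subset⟩)
  have hcover : L₁ ∪ P₁ ∪ L \ L₁ ∪ (M ∪ Q) = L ∪ P := by
    rw [hMQ]
    ext x
    simp only [Finset.mem_union, Finset.mem_sdiff]
    have := @hL₁ x
    have := @hP₁ x
    tauto
  have hJ : L ∪ P ∪ Z = J := by
    ext x
    simp only [hL, hP, hZ, Finset.mem_union, Finset.mem_filter]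
    grind
  obtain ⟨m, hm, hcase⟩ := hbase.add_small Z (by
      rw [hcover, Finset.disjoint_left]
      intro x
      simp only [hL, hP, hZ, Finset.mem_union, Finset.mem_filter]
      grind) (fun j hj => (Finset.mem_filter.1 hj).2)
    fun j hj => (h0 j (Finset.mem_filter.1 hj).1).le
  rw [hcover, hJ] at hm hcase
  rcases hcase with hcase | hcase
  · set ω : α → ℝ := fun j => (if j ∈ L then 7 / 6 else 0) - (if j ∈ L₁ then 1 / 3 else 0)
      + (if j ∈ P₁ then 1 / 6 else 0) + (if j ∈ M then 1 / 2 else 0)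
      + (if j ∈ Q then 1 / 3 else 0) with hω
    have hsum : ∑ j ∈ J, ω j = 7 / 6 * L.card - 1 / 3 * L₁.card + 1 / 6 * P₁.card
        + 1 / 2 * M.card + 1 / 3 * Q.card := by
      simp only [hω, Finset.sum_add_distrib, Finset.sum_sub_distrib, Finset.sum_ite_mem,
        Finset.inter_eq_right.2 hLJ, Finset.inter_eq_right.2 (hL₁.trans hLJ),
        Finset.inter_eq_right.2 (hP₁.trans hPJ), Finset.inter_eq_right.2 (hMP.trans hPJ),
        Finset.inter_eq_right.2 (hQP.trans hPJ), Finset.sum_const, nsmul_eq_mul]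
      ring
    have hLd : ∀ j, j ∈ L ↔ j ∈ J ∧ 1 / 2 < a j := by simp [hL]
    have hPd : ∀ j, j ∈ P ↔ j ∈ J ∧ 1 / 4 < a j ∧ a j ≤ 1 / 2 := by simp [hP]
    have hMd : ∀ j, j ∈ M ↔ (j ∈ P ∧ j ∉ P₁) ∧ 1 / 3 < a j := by simp [hM]
    have hQd : ∀ j, j ∈ Q ↔ (j ∈ P ∧ j ∉ P₁) ∧ ¬ 1 / 3 < a j := by simp [hQ]
    clear_value L P M Q ω
    have hωL : ∀ j ∈ J, 1 / 2 < a j → ω j = 5 / 6 ∨ j ∈ L \ L₁ ∧ ω j = 7 / 6 := by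
      intro j hj h
      have h1 : j ∈ L := (hLd j).2 ⟨hj, h⟩
      have h2 : j ∉ P := Finset.disjoint_left.1 hLP h1
      have h3 : j ∉ P₁ := fun h => h2 (hP₁ h)
      have h4 : j ∉ M := fun h => h2 (hMP h)
      have h5 : j ∉ Q := fun h => h2 (hQP h)
      by_cases h6 : j ∈ L₁
      · left; rw [hω]; simp only [h1, h3, h4, h5, h6, if_true, if_false]; norm_num
      · right; rw [hω]; simp [h1, h3, h4, h5, h6]
    have hωP : ∀ j ∈ J, 1 / 4 < a j → a j ≤ 1 / 2 → ω j = 1 / 6 ∨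
        j ∈ P \ P₁ ∧ (1 / 3 < a j ∧ ω j = 1 / 2 ∨ ω j = 1 / 3) := by
      intro j hj h h'
      have h1 : j ∈ P := (hPd j).2 ⟨hj, h, h'⟩
      have h2 : j ∉ L := Finset.disjoint_right.1 hLP h1
      have h3 : j ∉ L₁ := fun h => h2 (hL₁ h)
      by_cases h4 : j ∈ P₁
      · have h5 : j ∉ M := by rw [hMd]; tauto
        have h6 : j ∉ Q := by rw [hQd]; tauto
        left; rw [hω]; simp [h2, h3, h4, h5, h6]
      · refine .inr ⟨Finset.mem_sdiff.2 ⟨h1, h4⟩, ?_⟩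
        by_cases h7 : 1 / 3 < a j
        · have h5 : j ∈ M := by rw [hMd]; tauto
          have h6 : j ∉ Q := by rw [hQd]; tauto
          left; refine ⟨h7, ?_⟩; rw [hω]; simp [h2, h3, h4, h5, h6]
        · have h5 : j ∉ M := by rw [hMd]; tauto
          have h6 : j ∈ Q := by rw [hQd]; tauto
          right; rw [hω]; simp [h2, h3, h4, h5, h6]
    have hωZ : ∀ j ∈ J, a j ≤ 1 / 4 → ω j = 0 := by
      intro j hj h
      have h1 : j ∉ L := by rw [hLd]; intro h; linarith [h.2]
      have h2 : j ∉ P := by rw [hPd]; intro h; linarith [h.2.1]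
      have h3 : j ∉ P₁ := fun h => h2 (hP₁ h)
      have h4 : j ∉ M := fun h => h2 (hMP h)
      have h5 : j ∉ Q := fun h => h2 (hQP h)
      have h6 : j ∉ L₁ := fun h => h1 (hL₁ h)
      rw [hω]; simp [h1, h3, h4, h5, h6]
    refine ⟨m, ω, hm, ?_, fun j hj => ?_, fun T g hT hsumT => ?_⟩
    · have e1 : ((M.card / 2 : ℕ) : ℝ) ≤ M.card / 2 := Nat.cast_div_le
      have e2 : ((Q.card / 3 : ℕ) : ℝ) ≤ Q.card / 3 := Nat.cast_div_le
      have e3 : ((L \ L₁).card : ℝ) = L.card - L₁.card := by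
        rw [Finset.card_sdiff_of_subset hL₁, Nat.cast_sub (Finset.card_le_card hL₁)]
      have e4 : (L₁.card : ℝ) ≤ L.card := by exact_mod_cast Finset.card_le_card hL₁
      rw [hsum, ← hcard, hcase, Nat.div_one]
      push_cast
      linarith
    · rcases le_or_gt (a j) (1 / 4) with h | h
      · rw [hωZ j hj h]
      · rcases le_or_gt (a j) (1 / 2) with h' | h'
        · rcases hωP j hj h h' with h | ⟨-, ⟨-, h⟩ | h⟩ <;> rw [h] <;> norm_num
        · rcases hωL j hj h' with h | ⟨-, h⟩ <;> rw [h] <;> norm_num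
    · refine sum_weight_le T (fun i => a (g i)) (fun i => ω (g i)) (fun i => g i ∈ L \ L₁)
        (fun i => g i ∈ P \ P₁) (fun i hi => h0 _ (hT i hi)) (fun i hi h => ?_)
        (fun i hi h h' => ?_) (fun i hi h => hωZ _ (hT i hi) h)
        (fun i _ j _ hU hV => hmax _ hU _ hV) hsumT
      · exact (hωL _ (hT i hi) h).imp le_of_eq fun h => ⟨h.1, h.2.le⟩
      · rcases hωP _ (hT i hi) h h' with h | ⟨hV, ⟨h3, h⟩ | h⟩
        · exact .inl h.le
        · exact .inr ⟨hV, h.le, .inl h3⟩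
        · exact .inr ⟨hV, by linarith, .inr h.le⟩
  · refine ⟨m, fun j => 4 / 3 * a j, hm, ?_, fun j hj => by have := h0 j hj; positivity,
      fun T g _ hT => ?_⟩
    · rw [← Finset.mul_sum]; linarith
    · rw [← Finset.mul_sum]; linarith

/-- In a splitting into as few groups as possible, any two groups have total sum above `1`. -/
theorem Fits.exists_minimal {α : Type} [DecidableEq α] {a : α → ℝ} {J : Finset α} {m : ℕ}
    (H : Fits a J m) (h0 : ∀ j ∈ J, 0 ≤ a j) :
    ∃ n ≤ m, ∃ f : α → ℕ, (∀ j ∈ J, f j < n) ∧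
      (∀ b, ∑ j ∈ J.filter (fun j => f j = b), a j ≤ 1) ∧
      ∀ b c, b < c → c < n →
        1 < ∑ j ∈ J.filter (fun j => f j = b), a j + ∑ j ∈ J.filter (fun j => f j = c), a j := by
  classical
  have hex : ∃ n, Fits a J n := ⟨m, H⟩
  set n := Nat.find hex with hn
  obtain ⟨f, hf, hf'⟩ := Nat.find_spec hex
  refine ⟨n, Nat.find_min' hex H, f, hf, hf', fun b c hbc hcn => ?_⟩
  by_contra! hle
  refine Nat.find_min hex (show n - 1 < n by omega) ⟨fun j => if f j = c then b else
    if f j = n - 1 then c else f j, fun j hj => ?_, fun e => ?_⟩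
  · have := hf j hj
    rw [← hn] at this
    dsimp only
    split_ifs <;> omega
  · by_cases he : e = b
    · subst he
      refine le_trans ?_ hle
      rw [← Finset.sum_union (Finset.disjoint_filter.2 fun j _ h => by omega)]
      refine Finset.sum_le_sum_of_subset_of_nonneg (fun j hj => ?_) fun j hj _ => h0 j ?_
      · simp only [Finset.mem_filter, Finset.mem_union] at hj ⊢
        have := hj.2
        refine (em (f j = c)).symm.imp (fun h => ⟨hj.1, ?_⟩) fun h => ⟨hj.1, h⟩
        split_ifs at this <;> omega
      · simp only [Finset.mem_filter, Finset.mem_union] at hj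
        exact hj.elim And.left And.left
    · refine le_trans ?_ (hf' (if e = c then n - 1 else e))
      refine Finset.sum_le_sum_of_subset_of_nonneg (fun j hj => ?_) fun j hj _ =>
        h0 j (Finset.mem_of_mem_filter j hj)
      simp only [Finset.mem_filter] at hj ⊢
      refine ⟨hj.1, ?_⟩
      have := hj.2
      split_ifs at this ⊢ <;> omega

/-- A maximal initial segment of total height at most `1`, when ordering by decreasing width. -/
theorem exists_widest {ι : Type} [DecidableEq ι] {w h : ι → ℝ} {δ : ℝ} (X : Finset ι)
    (hδ : ∀ i ∈ X, h i ≤ δ) (hX : 1 < ∑ i ∈ X, h i) :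
    ∃ T ⊆ X, ∑ i ∈ T, h i ≤ 1 ∧ 1 - δ ≤ ∑ i ∈ T, h i ∧ ∀ i ∈ T, ∀ j ∈ X \ T, w j ≤ w i := by
  have key : ∀ c ≤ X.card, ∃ T ⊆ X, T.card = c ∧ (∑ i ∈ T, h i ≤ 1 ∨ ∃ T' ⊆ X,
      ∑ i ∈ T', h i ≤ 1 ∧ 1 - δ ≤ ∑ i ∈ T', h i ∧ ∀ i ∈ T', ∀ j ∈ X \ T', w j ≤ w i) ∧
      ∀ i ∈ T, ∀ j ∈ X \ T, w j ≤ w i := by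
    intro c
    induction c with
    | zero => exact fun _ => ⟨∅, by simp, rfl, .inl (by simp), by simp⟩
    | succ c ih =>
      intro hc
      obtain ⟨T, hT, hTc, h1, h2⟩ := ih (by omega)
      obtain ⟨k, hk, hk'⟩ := Finset.exists_max_image (X \ T) w (by
        rw [← Finset.card_pos, Finset.card_sdiff_of_subset hT]; omega)
      rw [Finset.mem_sdiff] at hk
      refine ⟨insert k T, Finset.insert_subset hk.1 hT, by rw [Finset.card_insert_of_notMem hk.2,
        hTc], ?_, fun i hi j hj => ?_⟩
      · rcases h1 with h1 | h1
        · rw [Finset.sum_insert hk.2]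
          by_cases hle : h k + ∑ i ∈ T, h i ≤ 1
          · exact .inl hle
          · exact .inr ⟨T, hT, h1, by linarith [hδ k hk.1], h2⟩
        · exact .inr h1
      · have hj' : j ∈ X \ T := Finset.sdiff_subset_sdiff subset_rfl (Finset.subset_insert _ _) hj
        rcases Finset.mem_insert.1 hi with rfl | hi
        · exact hk' j hj'
        · exact h2 i hi j hj'
  obtain ⟨T, hT, hTc, h1, -⟩ := key X.card le_rfl
  rw [Finset.eq_of_subset_of_card_le hT hTc.ge] at h1
  exact h1.resolve_left (by linarith)

/-- Linear grouping: except for a set `R` of total height at most `1`, all items are grouped into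
sets of total height at most `1`, dominated by representatives `J`; each representative is in turn
dominated by the items of a set of total height at least `1 - δ`. -/
theorem exists_grouping {ι : Type} [DecidableEq ι] {w h : ι → ℝ} {δ : ℝ} (hh : ∀ i, 0 < h i)
    (X : Finset ι) (hδ : ∀ i ∈ X, h i ≤ δ) (hδ1 : δ < 1) :
    ∃ R ⊆ X, ∃ J ⊆ X \ R, (X.Nonempty → R.Nonempty) ∧ ∑ i ∈ R, h i ≤ 1 ∧
      (∃ τ : ι → ι, (∀ i ∈ X \ R, τ i ∈ J ∧ w i ≤ w (τ i)) ∧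
        ∀ j ∈ J, ∑ i ∈ (X \ R).filter (fun i => τ i = j), h i ≤ 1) ∧
      ∃ Y ⊆ X, ∃ σ : ι → ι, (∀ i ∈ Y, σ i ∈ J ∧ w (σ i) ≤ w i) ∧
        ∀ j ∈ J, 1 - δ ≤ ∑ i ∈ Y.filter (fun i => σ i = j), h i := by
  induction hc : X.card using Nat.strong_induction_on generalizing X with
  | _ c ih =>
    by_cases hX : ∑ i ∈ X, h i ≤ 1
    · exact ⟨X, subset_rfl, ∅, by simp, id, hX, ⟨id, by simp, by simp⟩, ∅, by simp, id, by simp,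
        by simp⟩
    · push Not at hX
      obtain ⟨T, hTX, hT1, hTδ, hTw⟩ := exists_widest (w := w) X hδ hX
      have hTne : T.Nonempty := by
        by_contra! hT
        rw [hT, Finset.sum_empty] at hTδ
        linarith
      have hXT : (X \ T).Nonempty := by
        by_contra! hXT
        rw [Finset.sdiff_eq_empty_iff_subset] at hXT
        rw [hTX.antisymm hXT] at hT1
        linarith
      obtain ⟨R, hR, J, hJ, hRne, hR1, ⟨τ, hτ, hτ'⟩, Y, hY, σ, hσ, hσ'⟩ := ih (X \ T).card (by
          have := Finset.card_pos.2 hTne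
          have := Finset.card_le_card hTX
          rw [Finset.card_sdiff_of_subset hTX]; omega) (X \ T)
        (fun i hi => hδ i (Finset.sdiff_subset hi)) rfl
      obtain ⟨k, hk, hkw⟩ := Finset.exists_max_image R w (hRne hXT)
      have hkJ : k ∉ J := fun h => (Finset.mem_sdiff.1 (hJ h)).2 hk
      refine ⟨T, hTX, insert k J, Finset.insert_subset (hR hk) (hJ.trans Finset.sdiff_subset),
        fun _ => hTne, hT1, ⟨fun i => if i ∈ R then k else τ i, fun i hi => ?_, fun j hj => ?_⟩,
        Y ∪ T, Finset.union_subset (hY.trans Finset.sdiff_subset) hTX,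
        fun i => if i ∈ T then k else σ i, fun i hi => ?_, fun j hj => ?_⟩
      · dsimp only
        split_ifs with h
        · exact ⟨Finset.mem_insert_self _ _, hkw i h⟩
        · have := hτ i (Finset.mem_sdiff.2 ⟨hi, h⟩)
          exact ⟨Finset.mem_insert_of_mem this.1, this.2⟩
      · rcases Finset.mem_insert.1 hj with rfl | hj
        · refine le_trans (Finset.sum_le_sum_of_subset_of_nonneg (fun i hi => ?_)
            fun i _ _ => (hh i).le) hR1
          replace hi := Finset.mem_filter.1 hi
          dsimp only at hi
          by_contra hiR
          rw [if_neg hiR] at hi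
          exact hkJ (hi.2 ▸ (hτ i (Finset.mem_sdiff.2 ⟨hi.1, hiR⟩)).1)
        · refine le_trans (Finset.sum_le_sum_of_subset_of_nonneg (fun i hi => ?_)
            fun i _ _ => (hh i).le) (hτ' j hj)
          rw [Finset.mem_filter] at hi ⊢
          dsimp only at hi
          by_cases hiR : i ∈ R
          · rw [if_pos hiR] at hi
            exact absurd (hi.2 ▸ hj) hkJ
          · rw [if_neg hiR] at hi
            exact ⟨Finset.mem_sdiff.2 ⟨hi.1, hiR⟩, hi.2⟩
      · dsimp only
        split_ifs with h
        · exact ⟨Finset.mem_insert_self _ _, hTw i h k (hR hk)⟩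
        · have := hσ i ((Finset.mem_union.1 hi).resolve_right h)
          exact ⟨Finset.mem_insert_of_mem this.1, this.2⟩
      · rcases Finset.mem_insert.1 hj with rfl | hj
        · refine hTδ.trans (Finset.sum_le_sum_of_subset_of_nonneg (fun i hi => ?_)
            fun i _ _ => (hh i).le)
          simp [hi]
        · refine (hσ' j hj).trans (Finset.sum_le_sum_of_subset_of_nonneg (fun i hi => ?_)
            fun i _ _ => (hh i).le)
          rw [Finset.mem_filter] at hi ⊢
          refine ⟨Finset.mem_union_left _ hi.1, ?_⟩
          dsimp only
          rw [if_neg (Finset.mem_sdiff.1 (hY hi.1)).2, hi.2]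

/-- The items of a linear grouping belonging to a finite set `B` of groups of representatives, each
of total width in `[1/2, 1]`, form `B.card` blocks. -/
theorem Blocks.of_groups {ι : Type} [DecidableEq ι] {w h : ι → ℝ} (Z J : Finset ι) (τ : ι → ι)
    (hτ : ∀ i ∈ Z, τ i ∈ J ∧ w i ≤ w (τ i))
    (hτ' : ∀ j ∈ J, ∑ i ∈ Z.filter (fun i => τ i = j), h i ≤ 1) (f : ι → ℕ)
    (hf : ∀ b, ∑ j ∈ J.filter (fun j => f j = b), w j ≤ 1) (B : Finset ℕ)
    (hB : ∀ b ∈ B, 1 / 2 ≤ ∑ j ∈ J.filter (fun j => f j = b), w j) :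
    Blocks w h (Z.filter fun i => f (τ i) ∈ B) B.card
      (∑ b ∈ B, ∑ j ∈ J.filter (fun j => f j = b), w j) := by
  induction B using Finset.induction_on with
  | empty => simpa using Blocks.nil
  | insert b B hb ih =>
    have hblock : Block w h (Z.filter fun i => f (τ i) = b)
        (∑ j ∈ J.filter (fun j => f j = b), w j) 1 := by
      refine ⟨J.filter fun j => f j = b, τ, fun i hi => ?_, le_rfl, fun k hk => ?_⟩
      · rw [Finset.mem_filter] at hi
        exact ⟨Finset.mem_filter.2 ⟨(hτ i hi.1).1, hi.2⟩, (hτ i hi.1).2⟩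
      · rw [Finset.mem_filter] at hk
        convert hτ' k hk.1 using 2
        ext i
        simp only [Finset.mem_filter]
        constructor
        · exact fun hi => ⟨hi.1.1, hi.2⟩
        · exact fun hi => ⟨⟨hi.1, by rw [hi.2, hk.2]⟩, hi.2⟩
    have hd : Disjoint (Z.filter fun i => f (τ i) ∈ B) (Z.filter fun i => f (τ i) = b) :=
      Finset.disjoint_filter.2 fun i _ hi hi' => hb (hi' ▸ hi)
    have := Blocks.cons _ _ _ _ _ hd
      (ih fun c hc => hB c (Finset.mem_insert_of_mem hc)) hblock
      (hB b (Finset.mem_insert_self _ _)) (hf b)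
    rw [Finset.card_insert_of_notMem hb, Finset.sum_insert hb, add_comm (∑ j ∈ _, w j)]
    convert this using 1
    ext i
    simp only [Finset.mem_filter, Finset.mem_insert, Finset.mem_union]
    tauto

/-- All items of height at most `δ`, except for those fitting into two bins, form a sequence of
blocks whose total width and number are bounded in terms of the area and of any bin packing. -/
theorem exists_blocks {ι : Type} [Fintype ι] [DecidableEq ι] {w h : ι → ℝ} {N : ℕ}
    (P : BinPacking w h N) (hw : ∀ i, 0 < w i) (hw1 : ∀ i, w i ≤ 1) (hh : ∀ i, 0 < h i) {δ : ℝ}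
    (hδ : δ < 1) (X : Finset ι) (hX : ∀ i ∈ X, h i ≤ δ) :
    ∃ S ⊆ X, ∃ n φ, Blocks w h S n φ ∧ Bins w h (X \ S) 2 ∧
      φ * (1 - δ) ≤ ∑ i ∈ X, h i * w i ∧ n * (1 - δ) ≤ 4 / 3 * N + 3 * (1 - δ) := by
  obtain ⟨R, hR, J, hJ, -, hR1, ⟨τ, hτ, hτ'⟩, Y, hY, σ, hσ, hσ'⟩ := exists_grouping hh X hX hδ
  obtain ⟨m, ω, hfit, hm, hω, hωT⟩ := exists_fits_weight w J (fun j _ => hw j) fun j _ => hw1 j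
  obtain ⟨n, hnm, f, hfn, hf, hfmin⟩ := hfit.exists_minimal fun j _ => (hw j).le
  have hsum : ∀ u : ι → ℝ, (∀ j ∈ J, 0 ≤ u j) →
      (∑ j ∈ J, u j) * (1 - δ) ≤ ∑ i ∈ Y, h i * u (σ i) := fun u hu =>
    calc (∑ j ∈ J, u j) * (1 - δ)
        ≤ ∑ j ∈ J, u j * ∑ i ∈ Y.filter (fun i => σ i = j), h i := by
          rw [Finset.sum_mul]
          exact Finset.sum_le_sum fun j hj => mul_le_mul_of_nonneg_left (hσ' j hj) (hu j hj)
      _ = ∑ j ∈ J, ∑ i ∈ Y.filter (fun i => σ i = j), h i * u (σ i) := by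
          refine Finset.sum_congr rfl fun j _ => ?_
          rw [Finset.mul_sum]
          refine Finset.sum_congr rfl fun i hi => ?_
          rw [(Finset.mem_filter.1 hi).2, mul_comm]
      _ = ∑ i ∈ Y, h i * u (σ i) := Finset.sum_fiberwise_of_maps_to (fun i hi => (hσ i hi).1) _
  set B := (Finset.range n).filter fun b =>
    1 / 2 ≤ ∑ j ∈ J.filter (fun j => f j = b), w j with hB
  have hblocks := Blocks.of_groups (X \ R) J τ hτ hτ' f hf B fun b hb => (Finset.mem_filter.1 hb).2
  refine ⟨_, (Finset.filter_subset _ _).trans Finset.sdiff_subset, _, _, hblocks, ?_, ?_, ?_⟩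
  · have hrest : Block w h ((X \ R).filter fun i => f (τ i) ∉ B) 1 1 := by
      refine ⟨J.filter fun j => f j ∉ B, τ, fun i hi => ?_, ?_, fun k hk => ?_⟩
      · rw [Finset.mem_filter] at hi
        exact ⟨Finset.mem_filter.2 ⟨(hτ i hi.1).1, hi.2⟩, (hτ i hi.1).2⟩
      · rcases (J.filter fun j => f j ∉ B).eq_empty_or_nonempty with he | ⟨j, hj⟩
        · rw [he]; simp
        · refine le_trans (Finset.sum_le_sum_of_subset_of_nonneg (fun k hk => ?_)
            fun i _ _ => (hw i).le) (hf (f j))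
          rw [Finset.mem_filter] at hj hk ⊢
          refine ⟨hk.1, ?_⟩
          have hsmall : ∀ j, j ∈ J ∧ f j ∉ B → ∑ k ∈ J.filter (fun k => f k = f j), w k < 1 / 2 :=
            fun j hj => by
              by_contra! hle
              exact hj.2 (Finset.mem_filter.2 ⟨Finset.mem_range.2 (hfn j hj.1), hle⟩)
          have h1 := hsmall j hj
          have h2 := hsmall k hk
          by_contra hne
          rcases Nat.lt_or_gt_of_ne hne with hlt | hlt
          · linarith [hfmin _ _ hlt (hfn j hj.1)]
          · linarith [hfmin _ _ hlt (hfn k hk.1)]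
      · rw [Finset.mem_filter] at hk
        exact (Finset.sum_le_sum_of_subset_of_nonneg (Finset.filter_subset_filter _
          (Finset.filter_subset _ _)) fun i _ _ => (hh i).le).trans (hτ' k hk.1)
    have hcol : GPack w h R 1 1 := GPack.column R zero_le_one (fun i _ => hw1 i) hR1
    have hbins := Bins.cons _ _ _ (by
        rw [Finset.empty_union]
        exact (Finset.disjoint_sdiff.mono_right (Finset.filter_subset _ _)))
      (Bins.cons _ _ _ (Finset.disjoint_empty_left R) Bins.nil hcol)
      (hrest.gpack hw hh zero_le_one)
    convert hbins using 1
    ext i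
    simp only [Finset.mem_sdiff, Finset.mem_filter, Finset.mem_union, Finset.notMem_empty,
      false_or]
    have := @hR i
    tauto
  · have hδ' : 0 ≤ 1 - δ := by linarith
    calc (∑ b ∈ B, ∑ j ∈ J.filter (fun j => f j = b), w j) * (1 - δ)
        ≤ (∑ b ∈ Finset.range n, ∑ j ∈ J.filter (fun j => f j = b), w j) * (1 - δ) :=
          mul_le_mul_of_nonneg_right (Finset.sum_le_sum_of_subset_of_nonneg
            (Finset.filter_subset _ _) fun b _ _ => Finset.sum_nonneg fun j _ => (hw j).le) hδ'
      _ = (∑ j ∈ J, w j) * (1 - δ) := by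
          rw [Finset.sum_fiberwise_of_maps_to fun j hj => Finset.mem_range.2 (hfn j hj)]
      _ ≤ ∑ i ∈ Y, h i * w (σ i) := hsum w fun j _ => (hw j).le
      _ ≤ ∑ i ∈ Y, h i * w i := Finset.sum_le_sum fun i hi =>
          mul_le_mul_of_nonneg_left (hσ i hi).2 (hh i).le
      _ ≤ ∑ i ∈ X, h i * w i := Finset.sum_le_sum_of_subset_of_nonneg hY fun i _ _ =>
          (mul_pos (hh i) (hw i)).le
  · have h1 : (B.card : ℝ) ≤ ∑ j ∈ J, ω j + 3 := by
      have : B.card ≤ m := (Finset.card_filter_le _ _).trans (by simpa using hnm)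
      have : (B.card : ℝ) ≤ m := by exact_mod_cast this
      linarith
    have h2 : ∑ i, h i * (if i ∈ Y then ω (σ i) else 0) ≤ 4 / 3 * N := by
      refine P.sum_mul_le hw hh _ _ fun T hT => ?_
      rw [Finset.sum_ite_mem]
      refine hωT (T ∩ Y) σ (fun i hi => (hσ i (Finset.mem_inter.1 hi).2).1) ?_
      calc ∑ i ∈ T ∩ Y, w (σ i) ≤ ∑ i ∈ T ∩ Y, w i :=
            Finset.sum_le_sum fun i hi => (hσ i (Finset.mem_inter.1 hi).2).2
        _ ≤ ∑ i ∈ T, w i := Finset.sum_le_sum_of_subset_of_nonneg Finset.inter_subset_left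
            fun i _ _ => (hw i).le
        _ ≤ 1 := hT
    simp only [mul_ite, mul_zero, Finset.sum_ite_mem, Finset.univ_inter] at h2
    nlinarith [hsum ω hω]

/-- Combining the stocks of blocks of wide and of tall items. -/
theorem exists_bins_of_blocks {ι : Type} [DecidableEq ι] {w h : ι → ℝ} {δ V : ℝ} (hδ : 0 ≤ δ)
    (hδ' : δ ≤ 1 / 2) (hw : ∀ i, 0 < w i) (hh : ∀ i, 0 < h i) {S S' : Finset ι}
    (hS : ∀ i ∈ S, h i ≤ δ) (hS' : ∀ i ∈ S', w i ≤ δ) (hd : Disjoint S S') {n m : ℕ} {φ φ' : ℝ}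
    (H : Blocks w h S n φ) (H' : Blocks h w S' m φ') (hle : m ≤ n) (hV : 0 ≤ V)
    (hφ : (φ + φ') * (1 - δ) ≤ V) (hn : n * (1 - δ) ≤ 4 / 3 * V + 3 * (1 - δ)) :
    ∃ N, Bins w h (S ∪ S') N ∧ (N : ℝ) ≤ 4 / 3 * (1 + 8 * δ) * V + 4 := by
  have hstock : Stock w h S n 0 φ := ⟨∅, S, 1 / 2, φ, by simp, by simp,
    Block.empty w h (by norm_num) 0, le_rfl, zero_le_one, le_rfl, by norm_num, H, by simp⟩
  have hstock' : Stock h w S' m 0 φ' := ⟨∅, S', 1 / 2, φ', by simp, by simp,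
    Block.empty h w (by norm_num) 0, le_rfl, zero_le_one, le_rfl, by norm_num, H', by simp⟩
  obtain ⟨N, hN, hcase⟩ := hstock.mix_of_le hδ hδ' hw hh S S' hS hS' hd n m 0 φ 0 φ' hstock'
    (by simpa using hle)
  have hδ1 : 0 < 1 - δ := by linarith
  refine ⟨N, hN, ?_⟩
  rcases hcase with hcase | hcase
  · have hD : 0 < 3 / 4 - δ / 2 := by linarith
    have hφ' : φ + φ' ≤ V / (1 - δ) := by rwa [le_div_iff₀ hδ1]
    have key : V ≤ 4 / 3 * (1 + 8 * δ) * V * ((1 - δ) * (3 / 4 - δ / 2)) := by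
      have : 1 ≤ 4 / 3 * (1 + 8 * δ) * ((1 - δ) * (3 / 4 - δ / 2)) := by
        nlinarith [mul_nonneg hδ (sub_nonneg.2 hδ'), mul_nonneg (mul_nonneg hδ hδ) hδ]
      nlinarith
    have : V / (1 - δ) ≤ 4 / 3 * (1 + 8 * δ) * V * (3 / 4 - δ / 2) := by
      rw [div_le_iff₀ hδ1]; linarith
    refine le_of_mul_le_mul_right (le_trans hcase ?_) hD
    linarith
  · have hcase : (N : ℝ) ≤ n + 1 := by exact_mod_cast hcase
    refine hcase.trans (le_of_mul_le_mul_right ?_ hδ1)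
    have : V ≤ (1 + 8 * δ) * V * (1 - δ) := by
      have : 1 ≤ (1 + 8 * δ) * (1 - δ) := by nlinarith
      nlinarith
    linarith

/-- For `δ ∈ (0, 1/2]` and `ε ∈ (0,1)` with `1/ε ∈ ℤ`, every
finite set `I` of `δ`-skewed items admits a guillotinable packing into at most
`(4/3)(1+8δ)(1+7ε)·opt(I) + 8/ε² + 30` unit square bins. -/
theorem skewed4Pack_guarantee
    (δ ε : ℝ) (hδ0 : 0 < δ) (hδ : δ ≤ 1/2) (hε0 : 0 < ε) (hε1 : ε < 1)
    (hεint : ∃ z : ℤ, 1/ε = (z : ℝ))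
    (n : ℕ) (w h : Fin n → ℝ)
    (hw : ∀ i, 0 < w i ∧ w i ≤ 1) (hh : ∀ i, 0 < h i ∧ h i ≤ 1)
    (hskew : ∀ i, w i ≤ δ ∨ h i ≤ δ) :
    (optg w h : ℝ) ≤ 4/3 * (1 + 8*δ) * (1 + 7*ε) * (opt w h : ℝ) + 8/ε^2 + 30 := by
  have hw0 : ∀ i, 0 < w i := fun i => (hw i).1
  have hh0 : ∀ i, 0 < h i := fun i => (hh i).1
  have hw1 : ∀ i, w i ≤ 1 := fun i => (hw i).2
  have hh1 : ∀ i, h i ≤ 1 := fun i => (hh i).2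
  obtain ⟨P⟩ := exists_binPacking_opt hw1 hh1
  set V : ℝ := (opt w h : ℝ) with hV
  have hV0 : 0 ≤ V := Nat.cast_nonneg _
  have hδ1 : δ < 1 := by linarith
  set X := Finset.univ.filter fun i => h i ≤ δ with hX
  set X' := Finset.univ.filter fun i => ¬ h i ≤ δ with hX'
  have hXδ : ∀ i ∈ X, h i ≤ δ := fun i hi => (Finset.mem_filter.1 hi).2
  have hX'δ : ∀ i ∈ X', w i ≤ δ := fun i hi =>
    (hskew i).resolve_right (Finset.mem_filter.1 hi).2
  have hXX' : Disjoint X X' := Finset.disjoint_filter_filter_not _ _ _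
  obtain ⟨S, hS, n₁, φ, hB, hrest, hφ, hn₁⟩ := exists_blocks P hw0 hw1 hh0 hδ1 X hXδ
  obtain ⟨S', hS', n₂, φ', hB', hrest', hφ', hn₂⟩ :=
    exists_blocks P.transpose hh0 hh1 hw0 hδ1 X' hX'δ
  have harea : (φ + φ') * (1 - δ) ≤ V := by
    have h1 : ∑ i, h i * w i ≤ 1 * V := P.sum_mul_le hw0 hh0 w 1 fun T hT => hT
    rw [← Finset.sum_filter_add_sum_filter_not Finset.univ (fun i => h i ≤ δ)] at h1
    have h2 : ∑ i ∈ X', w i * h i = ∑ i ∈ X', h i * w i :=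
      Finset.sum_congr rfl fun i _ => mul_comm _ _
    linarith
  have hSδ : ∀ i ∈ S, h i ≤ δ := fun i hi => hXδ i (hS hi)
  have hS'δ : ∀ i ∈ S', w i ≤ δ := fun i hi => hX'δ i (hS' hi)
  have hSS' : Disjoint S S' := hXX'.mono hS hS'
  obtain ⟨N, hN, hNle⟩ : ∃ N, Bins w h (S ∪ S') N ∧
      (N : ℝ) ≤ 4 / 3 * (1 + 8 * δ) * V + 4 := by
    rcases le_total n₂ n₁ with hle | hle
    · exact exists_bins_of_blocks hδ0.le hδ hw0 hh0 hSδ hS'δ hSS' hB hB' hle hV0 harea hn₁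
    · obtain ⟨N, hN, hNle⟩ := exists_bins_of_blocks hδ0.le hδ hh0 hw0 hS'δ hSδ hSS'.symm hB' hB
        hle hV0 (by linarith) hn₂
      exact ⟨N, by rw [Finset.union_comm]; exact hN.transpose, hNle⟩
  have hall : Bins w h Finset.univ (N + (2 + 2)) := by
    have := hN.union (hrest.union hrest'.transpose
      (hXX'.mono Finset.sdiff_subset Finset.sdiff_subset)) (by
        rw [Finset.disjoint_union_left, Finset.disjoint_union_right, Finset.disjoint_union_right]
        exact ⟨⟨Finset.disjoint_sdiff, hXX'.mono hS Finset.sdiff_subset⟩,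
          (hXX'.mono Finset.sdiff_subset hS').symm, Finset.disjoint_sdiff⟩)
    rwa [Finset.union_union_union_comm, Finset.union_sdiff_of_subset hS,
      Finset.union_sdiff_of_subset hS', Finset.filter_union_filter_not_eq] at this
  have hoptg : (optg w h : ℝ) ≤ N + 4 := by exact_mod_cast hall.optg_le hw0 hh0
  have hεV : 4 / 3 * (1 + 8 * δ) * V ≤ 4 / 3 * (1 + 8 * δ) * (1 + 7 * ε) * V := by
    have : 0 ≤ 4 / 3 * (1 + 8 * δ) * V * (7 * ε) := by positivity
    linarith
  have hε2 : 0 ≤ 8 / ε ^ 2 := by positivity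
  linarith
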